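/- arXiv:2602.16517 — 2 statements merged into one kernel-verified Lean document; each statement's English description precedes it below -/
import Mathlib

section
/- There exists a C^∞ function f : [−1,1]² → ℝ with a unique critical point at the origin (i.e. ∇f vanishes at (0,0) and nowhere else), and a constant C < ∞ such that for every (x,y) ∈ [−1,1]² both f(x,y) − inf_{x'∈[−1,1]} f(x',y) ≤ C|∂_x f(x,y)|² and sup_{y'∈[−1,1]} f(x,y') − f(x,y) ≤ C|∂_y f(x,y)|² hold, and yet there is a nonempty open subset U of [−1,1]² such that for every initial condition z(0) ∈ U, the gradient descent-ascent flow z solving z'(t) = (−∂_x f(z(t)), ∂_y f(z(t))) is a nonconstant periodic trajectory. -/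
open Set Filter

/-- Partial derivative in the first variable. -/
noncomputable def pdx (f : ℝ × ℝ → ℝ) (p : ℝ × ℝ) : ℝ :=
  deriv (fun x => f (x, p.2)) p.1

/-- Partial derivative in the second variable. -/
noncomputable def pdy (f : ℝ × ℝ → ℝ) (p : ℝ × ℝ) : ℝ :=
  deriv (fun y => f (p.1, y)) p.2

/-- The square `[-1,1]²`. -/
def Sq : Set (ℝ × ℝ) := Icc (-1) 1 ×ˢ Icc (-1) 1


set_option maxHeartbeats 2000000

/-- The bump in the variable `cos 2θ`. -/
noncomputable def bb (s : ℝ) : ℝ := expNegInvGlue ((s - 1/4) * (3/4 - s))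

/-- The off-axis correction. -/
noncomputable def WW (p : ℝ × ℝ) : ℝ :=
  -((p.1^2 + p.2^2) * Real.smoothTransition (8 * (p.1^2 + p.2^2) - 1)) *
    bb ((p.1^2 - p.2^2) / (p.1^2 + p.2^2))

/-- The function. -/
noncomputable def ff (e c : ℝ) (p : ℝ × ℝ) : ℝ :=
  p.1 * p.2 + e * (p.1^2 - p.2^2) / 2 + c * WW p

/-- radial rate -/
noncomputable def nn (t : ℝ) : ℝ :=
  2 * Real.cos (2*t) * bb (Real.cos (2*t)) + 2 * (1 - Real.cos (2*t)^2) * deriv bb (Real.cos (2*t))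

/-- angular rate -/
noncomputable def dd (t : ℝ) : ℝ :=
  - 2 * Real.sin (2*t) * (bb (Real.cos (2*t)) - Real.cos (2*t) * deriv bb (Real.cos (2*t)))

lemma bb_contDiff : ContDiff ℝ (⊤ : ℕ∞) bb := by
  unfold bb
  exact expNegInvGlue.contDiff.comp (by fun_prop)

lemma bb_hasDerivAt (s : ℝ) : HasDerivAt bb (deriv bb s) s :=
  ((bb_contDiff.differentiable (by simp)) s).hasDerivAt

lemma bb_deriv_cont : Continuous (deriv bb) :=
  bb_contDiff.continuous_deriv (by simp)

lemma bb_cont : Continuous bb := bb_contDiff.continuous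

lemma bb_nonneg (s : ℝ) : 0 ≤ bb s := expNegInvGlue.nonneg _

lemma bb_zero {s : ℝ} (h : s ≤ 1/4 ∨ 3/4 ≤ s) : bb s = 0 := by
  apply expNegInvGlue.zero_of_nonpos
  rcases h with h | h <;> nlinarith

lemma bb_half : 0 < bb (1/2) := by
  apply expNegInvGlue.pos_of_pos; norm_num

lemma WW_contDiff : ContDiff ℝ (⊤ : ℕ∞) WW := by
  rw [contDiff_iff_contDiffAt]
  intro p
  by_cases hp : p.1^2 + p.2^2 = 0
  · have h0 : WW =ᶠ[nhds p] fun _ => 0 := by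
      have : ∀ᶠ q : ℝ × ℝ in nhds p, q.1^2 + q.2^2 < 1/8 := by
        apply (by fun_prop : Continuous fun q : ℝ × ℝ => q.1^2 + q.2^2).continuousAt.eventually_lt
          continuousAt_const
        rw [hp]; norm_num
      filter_upwards [this] with q hq
      unfold WW
      rw [Real.smoothTransition.zero_of_nonpos (by linarith)]
      simp
    exact contDiffAt_const.congr_of_eventuallyEq h0
  · unfold WW
    have h1 : ContDiffAt ℝ (⊤ : ℕ∞) (fun q : ℝ × ℝ => (q.1^2 - q.2^2) / (q.1^2 + q.2^2)) p := by
      have a1 : ContDiffAt ℝ (⊤ : ℕ∞) (fun q : ℝ × ℝ => q.1^2 - q.2^2) p := by fun_prop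
      have a2 : ContDiffAt ℝ (⊤ : ℕ∞) (fun q : ℝ × ℝ => q.1^2 + q.2^2) p := by fun_prop
      exact ContDiffAt.div a1 a2 hp
    have h2 := bb_contDiff.contDiffAt.comp p h1
    have h3 : ContDiffAt ℝ (⊤ : ℕ∞)
        (fun q : ℝ × ℝ => Real.smoothTransition (8 * (q.1^2 + q.2^2) - 1)) p :=
      Real.smoothTransition.contDiffAt.comp p (by fun_prop)
    have h4 : ContDiffAt ℝ (⊤ : ℕ∞) (fun q : ℝ × ℝ => (q.1^2 + q.2^2)) p := by fun_prop
    exact ((h4.mul h3).neg).mul h2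

lemma WW_zero {p : ℝ × ℝ} (h : |p.1| ≤ 1/8 ∨ |p.2| ≤ 1/8) : WW p = 0 := by
  unfold WW
  by_cases h1 : p.1^2 + p.2^2 ≤ 1/8
  · rw [Real.smoothTransition.zero_of_nonpos (by linarith)]; simp
  · push Not at h1
    rw [bb_zero]; · simp
    have hpos : 0 < p.1^2 + p.2^2 := by linarith
    rcases h with h | h
    · left
      have := sq_le_sq' (abs_le.1 h).1 (abs_le.1 h).2
      rw [div_le_iff₀ hpos]; nlinarith
    · right
      have := sq_le_sq' (abs_le.1 h).1 (abs_le.1 h).2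
      rw [le_div_iff₀ hpos]; nlinarith

lemma WW_diff_x (p : ℝ × ℝ) :
    HasDerivAt (fun x => WW (x, p.2)) (fderiv ℝ WW p (1, 0)) p.1 := by
  have h := ((WW_contDiff.differentiable (by simp)) p).hasFDerivAt
  have h2 : HasDerivAt (fun x : ℝ => (x, p.2)) ((1:ℝ), (0:ℝ)) p.1 :=
    (hasDerivAt_id _).prodMk (hasDerivAt_const _ _)
  exact HasFDerivAt.comp_hasDerivAt (x := p.1) (f := fun x : ℝ => (x, p.2)) h h2

lemma WW_diff_y (p : ℝ × ℝ) :
    HasDerivAt (fun y => WW (p.1, y)) (fderiv ℝ WW p (0, 1)) p.2 := by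
  have h := ((WW_contDiff.differentiable (by simp)) p).hasFDerivAt
  have h2 : HasDerivAt (fun y : ℝ => (p.1, y)) ((0:ℝ), (1:ℝ)) p.2 :=
    (hasDerivAt_const _ _).prodMk (hasDerivAt_id _)
  exact HasFDerivAt.comp_hasDerivAt (x := p.2) (f := fun y : ℝ => (p.1, y)) h h2

lemma pdx_ff (e c : ℝ) (p : ℝ × ℝ) : pdx (ff e c) p = p.2 + e * p.1 + c * pdx WW p := by
  have h := WW_diff_x p
  have h2 : pdx WW p = fderiv ℝ WW p (1, 0) := h.deriv
  rw [h2]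
  have h3 : HasDerivAt (fun x => x * p.2 + e * (x^2 - p.2^2) / 2) (p.2 + e * p.1) p.1 := by
    have := ((hasDerivAt_id p.1).mul_const p.2).add
      (((((hasDerivAt_id p.1).pow 2).sub_const (p.2^2)).const_mul e).div_const 2)
    refine this.congr_deriv ?_
    simp; ring
  exact (h3.add (h.const_mul c)).deriv

lemma pdy_ff (e c : ℝ) (p : ℝ × ℝ) : pdy (ff e c) p = p.1 - e * p.2 + c * pdy WW p := by
  have h := WW_diff_y p
  have h2 : pdy WW p = fderiv ℝ WW p (0, 1) := h.deriv
  rw [h2]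
  have h3 : HasDerivAt (fun y => p.1 * y + e * (p.1^2 - y^2) / 2) (p.1 - e * p.2) p.2 := by
    have := ((hasDerivAt_id p.2).const_mul p.1).add
      (((((hasDerivAt_id p.2).pow 2).const_sub (p.1^2)).const_mul e).div_const 2)
    refine this.congr_deriv ?_
    simp; ring
  exact (h3.add (h.const_mul c)).deriv

lemma pdx_WW_zero {p : ℝ × ℝ} (h : |p.2| ≤ 1/8) : pdx WW p = 0 := by
  unfold pdx
  have : (fun x => WW (x, p.2)) = fun _ => 0 := by
    ext x; exact WW_zero (Or.inr h)
  rw [this]; simp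

lemma pdy_WW_zero {p : ℝ × ℝ} (h : |p.1| ≤ 1/8) : pdy WW p = 0 := by
  unfold pdy
  have : (fun y => WW (p.1, y)) = fun _ => 0 := by
    ext x; exact WW_zero (Or.inl h)
  rw [this]; simp

lemma WW_near {p : ℝ × ℝ} (h : 1/4 < p.1^2 + p.2^2) :
    WW p = -(p.1^2 + p.2^2) * bb ((p.1^2 - p.2^2) / (p.1^2 + p.2^2)) := by
  unfold WW
  rw [Real.smoothTransition.one_of_one_le (by linarith)]; simp

lemma pdx_WW_near {p : ℝ × ℝ} (h : 1/4 < p.1^2 + p.2^2) :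
    pdx WW p = -2 * p.1 * (bb ((p.1^2 - p.2^2) / (p.1^2 + p.2^2)) +
      (1 - (p.1^2 - p.2^2) / (p.1^2 + p.2^2)) *
        deriv bb ((p.1^2 - p.2^2) / (p.1^2 + p.2^2))) := by
  have hpos : p.1^2 + p.2^2 ≠ 0 := by linarith
  have hev : (fun x => WW (x, p.2)) =ᶠ[nhds p.1]
      fun x => -(x^2 + p.2^2) * bb ((x^2 - p.2^2) / (x^2 + p.2^2)) := by
    have : ∀ᶠ x : ℝ in nhds p.1, 1/4 < x^2 + p.2^2 :=
      continuousAt_const.eventually_lt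
        (by fun_prop : Continuous fun x : ℝ => x^2 + p.2^2).continuousAt h
    filter_upwards [this] with x hx
    exact WW_near (p := (x, p.2)) hx
  unfold pdx
  rw [hev.deriv_eq]
  have h1 : HasDerivAt (fun x : ℝ => x^2 + p.2^2) (2 * p.1) p.1 := by
    simpa using ((hasDerivAt_id p.1).pow 2).add_const (p.2^2)
  have h2 : HasDerivAt (fun x : ℝ => x^2 - p.2^2) (2 * p.1) p.1 := by
    simpa using ((hasDerivAt_id p.1).pow 2).sub_const (p.2^2)
  have h3 := (bb_hasDerivAt ((p.1^2 - p.2^2) / (p.1^2 + p.2^2))).comp p.1 (h2.div h1 hpos)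
  have h4 := (h1.neg.mul h3).deriv
  refine h4.trans ?_
  simp only [Function.comp, Pi.neg_apply, Pi.div_apply]
  field_simp
  ring

lemma pdy_WW_near {p : ℝ × ℝ} (h : 1/4 < p.1^2 + p.2^2) :
    pdy WW p = -2 * p.2 * (bb ((p.1^2 - p.2^2) / (p.1^2 + p.2^2)) -
      (1 + (p.1^2 - p.2^2) / (p.1^2 + p.2^2)) *
        deriv bb ((p.1^2 - p.2^2) / (p.1^2 + p.2^2))) := by
  have hpos : p.1^2 + p.2^2 ≠ 0 := by linarith
  have hev : (fun y => WW (p.1, y)) =ᶠ[nhds p.2]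
      fun y => -(p.1^2 + y^2) * bb ((p.1^2 - y^2) / (p.1^2 + y^2)) := by
    have : ∀ᶠ y : ℝ in nhds p.2, 1/4 < p.1^2 + y^2 :=
      continuousAt_const.eventually_lt
        (by fun_prop : Continuous fun y : ℝ => p.1^2 + y^2).continuousAt h
    filter_upwards [this] with y hy
    exact WW_near (p := (p.1, y)) hy
  unfold pdy
  rw [hev.deriv_eq]
  have h1 : HasDerivAt (fun y : ℝ => p.1^2 + y^2) (2 * p.2) p.2 := by
    simpa using ((hasDerivAt_id p.2).pow 2).const_add (p.1^2)
  have h2 : HasDerivAt (fun y : ℝ => p.1^2 - y^2) (-(2 * p.2)) p.2 := by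
    simpa using ((hasDerivAt_id p.2).pow 2).const_sub (p.1^2)
  have h3 := (bb_hasDerivAt ((p.1^2 - p.2^2) / (p.1^2 + p.2^2))).comp p.2 (h2.div h1 hpos)
  have h4 := (h1.neg.mul h3).deriv
  refine h4.trans ?_
  simp only [Function.comp, Pi.neg_apply, Pi.div_apply]
  field_simp
  ring

lemma polar_v {r t : ℝ} (hr : r ≠ 0) :
    ((r * Real.cos t)^2 - (r * Real.sin t)^2) / ((r * Real.cos t)^2 + (r * Real.sin t)^2)
      = Real.cos (2*t) := by
  have h : (r * Real.cos t)^2 + (r * Real.sin t)^2 = r^2 := by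
    have := Real.sin_sq_add_cos_sq t; linear_combination r^2 * this
  rw [h, Real.cos_two_mul']
  field_simp

lemma polar_x {e c r t : ℝ} (hr : 1/2 < r) :
    -(pdx (ff e c) (r * Real.cos t, r * Real.sin t)) =
      r * (c * nn t - e) * Real.cos t - r * Real.sin t * (1 + c * dd t) := by
  have h0 : (r * Real.cos t)^2 + (r * Real.sin t)^2 = r^2 := by
    have := Real.sin_sq_add_cos_sq t; linear_combination r^2 * this
  rw [pdx_ff, pdx_WW_near (by simp only [h0]; nlinarith)]
  simp only [polar_v (show r ≠ 0 by linarith)]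
  unfold nn dd
  generalize bb (Real.cos (2*t)) = b
  generalize deriv bb (Real.cos (2*t)) = b'
  have h1 : Real.sin t ^ 2 = 1 - Real.cos t ^ 2 := Real.sin_sq t
  rw [Real.sin_two_mul, Real.cos_two_mul]
  have e3 : Real.sin t ^ 3 = Real.sin t * (1 - Real.cos t ^ 2) := by rw [← h1]; ring
  ring_nf
  try rw [h1]
  try ring_nf

lemma polar_y {e c r t : ℝ} (hr : 1/2 < r) :
    pdy (ff e c) (r * Real.cos t, r * Real.sin t) =
      r * (c * nn t - e) * Real.sin t + r * Real.cos t * (1 + c * dd t) := by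
  have h0 : (r * Real.cos t)^2 + (r * Real.sin t)^2 = r^2 := by
    have := Real.sin_sq_add_cos_sq t; linear_combination r^2 * this
  rw [pdy_ff, pdy_WW_near (by simp only [h0]; nlinarith)]
  simp only [polar_v (show r ≠ 0 by linarith)]
  unfold nn dd
  generalize bb (Real.cos (2*t)) = b
  generalize deriv bb (Real.cos (2*t)) = b'
  have h1 : Real.sin t ^ 2 = 1 - Real.cos t ^ 2 := Real.sin_sq t
  rw [Real.sin_two_mul, Real.cos_two_mul]
  ring_nf
  try rw [h1]
  try ring_nf

lemma nn_cont : Continuous nn := by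
  have := bb_cont; have := bb_deriv_cont
  unfold nn; fun_prop

lemma dd_cont : Continuous dd := by
  have := bb_cont; have := bb_deriv_cont
  unfold dd; fun_prop

lemma nn_per : Function.Periodic nn (2 * Real.pi) := by
  intro t
  have : Real.cos (2 * (t + 2 * Real.pi)) = Real.cos (2*t) := by
    rw [show 2 * (t + 2 * Real.pi) = 2*t + 2*Real.pi + 2*Real.pi by ring]; simp
  simp only [nn, this]

lemma dd_per : Function.Periodic dd (2 * Real.pi) := by
  intro t
  have : Real.cos (2 * (t + 2 * Real.pi)) = Real.cos (2*t) := by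
    rw [show 2 * (t + 2 * Real.pi) = 2*t + 2*Real.pi + 2*Real.pi by ring]; simp
  have h : Real.sin (2 * (t + 2 * Real.pi)) = Real.sin (2*t) := by
    rw [show 2 * (t + 2 * Real.pi) = 2*t + 2*Real.pi + 2*Real.pi by ring]; simp
  simp only [dd, this, h]

lemma nn_int : 0 < ∫ t in (0:ℝ)..(2 * Real.pi), nn t := by
  have hb := bb_cont
  have hb' := bb_deriv_cont
  have key : ∀ t, HasDerivAt (fun t => - (Real.sin (2*t) * bb (Real.cos (2*t))))
      (nn t - 4 * (Real.cos (2*t) * bb (Real.cos (2*t)))) t := by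
    intro t
    have l : HasDerivAt (fun t : ℝ => 2 * t) 2 t := by
      simpa using (hasDerivAt_id t).const_mul 2
    have h1 : HasDerivAt (fun t => Real.sin (2*t)) (Real.cos (2*t) * 2) t := l.sin
    have h2 : HasDerivAt (fun t => Real.cos (2*t)) (-Real.sin (2*t) * 2) t := l.cos
    have h3 := (bb_hasDerivAt (Real.cos (2*t))).comp t h2
    refine ((h1.mul h3).neg).congr_deriv ?_
    unfold nn
    simp only [Function.comp]
    have := Real.sin_sq (2*t)
    linear_combination (2 * deriv bb (Real.cos (2*t))) * this
  have hc : Continuous fun t => 4 * (Real.cos (2*t) * bb (Real.cos (2*t))) := by fun_prop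
  have h1 := intervalIntegral.integral_eq_sub_of_hasDerivAt (a := 0) (b := 2 * Real.pi)
    (fun t _ => key t) ((nn_cont.sub hc).intervalIntegrable _ _)
  rw [intervalIntegral.integral_sub (nn_cont.intervalIntegrable _ _)
    (hc.intervalIntegrable _ _)] at h1
  have s0 : Real.sin (2 * (2 * Real.pi)) = 0 := by
    rw [show 2 * (2 * Real.pi) = 2*Real.pi + 2*Real.pi by ring]; simp
  simp only [s0, mul_zero, Real.sin_zero, zero_mul, neg_zero, sub_zero] at h1
  have h2 : 0 < ∫ t in (0:ℝ)..(2 * Real.pi), 4 * (Real.cos (2*t) * bb (Real.cos (2*t))) := by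
    apply intervalIntegral.integral_pos (by positivity) hc.continuousOn
    · intro x _
      rcases le_total (Real.cos (2*x)) 0 with h | h
      · rw [bb_zero (Or.inl (by linarith))]; simp
      · have := bb_nonneg (Real.cos (2*x)); positivity
    · refine ⟨Real.pi / 6, ⟨by positivity, by linarith [Real.pi_pos]⟩, ?_⟩
      rw [show 2 * (Real.pi / 6) = Real.pi / 3 by ring, Real.cos_pi_div_three]
      have := bb_half; positivity
  linarith

lemma nd_bound : ∃ B : ℝ, 1 ≤ B ∧ (∀ t, |nn t| ≤ B) ∧ (∀ t, |dd t| ≤ B) := by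
  obtain ⟨B1, h1⟩ := (isCompact_Icc (a := (0:ℝ)) (b := 2 * Real.pi)).exists_bound_of_continuousOn
    nn_cont.continuousOn
  obtain ⟨B2, h2⟩ := (isCompact_Icc (a := (0:ℝ)) (b := 2 * Real.pi)).exists_bound_of_continuousOn
    dd_cont.continuousOn
  have hp : (0:ℝ) < 2 * Real.pi := by positivity
  refine ⟨max 1 (max B1 B2), le_max_left _ _, ?_, ?_⟩
  · intro t
    obtain ⟨s, hs, e⟩ := nn_per.exists_mem_Ico₀ hp t
    rw [e]
    exact (h1 s ⟨hs.1, hs.2.le⟩).trans ((le_max_left _ _).trans (le_max_right _ _))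
  · intro t
    obtain ⟨s, hs, e⟩ := dd_per.exists_mem_Ico₀ hp t
    rw [e]
    exact (h2 s ⟨hs.1, hs.2.le⟩).trans ((le_max_right _ _).trans (le_max_right _ _))

lemma W_bound : ∃ B : ℝ, 1 ≤ B ∧ ∀ p ∈ Sq, |WW p| ≤ B ∧ |pdx WW p| ≤ B ∧ |pdy WW p| ≤ B := by
  have hK : IsCompact Sq := isCompact_Icc.prod isCompact_Icc
  have hd : Continuous (fderiv ℝ WW) := WW_contDiff.continuous_fderiv (by simp)
  have ex : pdx WW = fun p => fderiv ℝ WW p (1, 0) := by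
    ext p; exact (WW_diff_x p).deriv
  have ey : pdy WW = fun p => fderiv ℝ WW p (0, 1) := by
    ext p; exact (WW_diff_y p).deriv
  obtain ⟨B0, h0⟩ := hK.exists_bound_of_continuousOn WW_contDiff.continuous.continuousOn
  obtain ⟨B1, h1⟩ := hK.exists_bound_of_continuousOn (f := pdx WW)
    (by rw [ex]; exact (hd.clm_apply continuous_const).continuousOn)
  obtain ⟨B2, h2⟩ := hK.exists_bound_of_continuousOn (f := pdy WW)
    (by rw [ey]; exact (hd.clm_apply continuous_const).continuousOn)
  refine ⟨max 1 (max B0 (max B1 B2)), le_max_left _ _, fun p hp => ⟨?_, ?_, ?_⟩⟩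
  · exact (h0 p hp).trans ((le_max_left _ _).trans (le_max_right _ _))
  · exact (h1 p hp).trans
      ((le_max_left _ _).trans ((le_max_right _ _).trans (le_max_right _ _)))
  · exact (h2 p hp).trans
      ((le_max_right _ _).trans ((le_max_right _ _).trans (le_max_right _ _)))

/-- Solving the angular equation. -/
lemma clock (D : ℝ → ℝ) (hD : Continuous D) (h1 : ∀ t, 1/2 ≤ D t) (h2 : ∀ t, D t ≤ 2)
    (hp : Function.Periodic D (2 * Real.pi)) :
    ∃ (Θ : ℝ → ℝ) (T : ℝ), 0 < T ∧ (∀ t, Θ (t + T) = Θ t + 2 * Real.pi) ∧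
      (∀ t, HasDerivAt Θ (D (Θ t)) t) ∧ Function.Surjective Θ := by
  have hpos : ∀ t, 0 < D t := fun t => by linarith [h1 t]
  have hDi : Continuous fun t => (D t)⁻¹ := hD.inv₀ (fun t => (hpos t).ne')
  set τ : ℝ → ℝ := fun u => ∫ t in (0:ℝ)..u, (D t)⁻¹ with hτ
  have hder : ∀ u, HasDerivAt τ (D u)⁻¹ u := fun u => (hDi.integral_hasStrictDerivAt 0 u).hasDerivAt
  have hcont : Continuous τ := continuous_iff_continuousAt.2 fun u => (hder u).continuousAt
  have hmono : StrictMono τ := strictMono_of_deriv_pos fun u => by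
    rw [(hder u).deriv]; exact inv_pos.2 (hpos u)
  have hmono2 : Monotone fun u => τ u - u / 2 := by
    apply monotone_of_deriv_nonneg
    · intro u; exact ((hder u).sub ((hasDerivAt_id u).div_const 2)).differentiableAt
    · intro u
      have : deriv (fun u => τ u - u / 2) u = (D u)⁻¹ - 1/2 :=
        ((hder u).sub ((hasDerivAt_id u).div_const 2)).deriv
      rw [this]
      have : (2:ℝ)⁻¹ ≤ (D u)⁻¹ := inv_anti₀ (hpos u) (h2 u)
      linarith
  have hτ0 : τ 0 = 0 := by simp [hτ]
  have htop : Tendsto τ atTop atTop := by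
    apply tendsto_atTop_mono' _ _ (tendsto_id.atTop_div_const (show (0:ℝ) < 2 by norm_num))
    filter_upwards [eventually_ge_atTop 0] with u hu
    have := hmono2 hu
    simp only [hτ0] at this
    simp only [id]; linarith
  have hbot : Tendsto τ atBot atBot := by
    apply tendsto_atBot_mono' _ _ (tendsto_id.atBot_div_const (show (0:ℝ) < 2 by norm_num))
    filter_upwards [eventually_le_atBot 0] with u hu
    have := hmono2 hu
    simp only [hτ0] at this
    simp only [id]; linarith
  have hsurj : Function.Surjective τ := hcont.surjective htop hbot
  let φ := hmono.orderIsoOfSurjective τ hsurj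
  have hφ : ∀ u, φ u = τ u := fun u => rfl
  have hinv : ∀ t, τ (φ.symm t) = t := fun t => φ.apply_symm_apply t
  have hper : ∀ u, τ (u + 2 * Real.pi) = τ u + τ (2 * Real.pi) := by
    intro u
    have hpi : Function.Periodic (fun t => (D t)⁻¹) (2 * Real.pi) := fun t => by
      simp only [hp t]
    have e := hpi.intervalIntegral_add_eq u 0
    rw [zero_add] at e
    simp only [hτ]
    rw [← e, intervalIntegral.integral_add_adjacent_intervals] <;>
      exact hDi.intervalIntegrable _ _
  refine ⟨φ.symm, τ (2 * Real.pi), ?_, ?_, ?_, φ.symm.surjective⟩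
  · rw [← hτ0]; exact hmono (by positivity)
  · intro t
    apply hmono.injective
    rw [hinv, hper, hinv]
  · intro t
    have := HasDerivAt.of_local_left_inverse (f := τ) (g := φ.symm) (a := t)
      φ.symm.continuous.continuousAt (hder _) (inv_pos.2 (hpos _)).ne'
      (Filter.Eventually.of_forall hinv)
    simpa using this

/-- The choice of parameters. -/
lemma params : ∃ e c B : ℝ, 0 < e ∧ 0 < c ∧ 1 ≤ B ∧ e ≤ 1/1000 ∧ c * B ≤ 1/1000 ∧
    (∀ p ∈ Sq, |WW p| ≤ B ∧ |pdx WW p| ≤ B ∧ |pdy WW p| ≤ B) ∧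
    (∀ t, |nn t| ≤ B) ∧ (∀ t, |dd t| ≤ B) ∧
    ∫ t in (0:ℝ)..(2 * Real.pi), (c * nn t - e) / (1 + c * dd t) = 0 := by
  obtain ⟨B1, hB1, hn, hd⟩ := nd_bound
  obtain ⟨B2, hB2, hW⟩ := W_bound
  set B := max B1 B2 with hB
  have hBB : 1 ≤ B := hB1.trans (le_max_left _ _)
  have hn : ∀ t, |nn t| ≤ B := fun t => (hn t).trans (le_max_left _ _)
  have hd : ∀ t, |dd t| ≤ B := fun t => (hd t).trans (le_max_left _ _)
  set I := ∫ t in (0:ℝ)..(2 * Real.pi), nn t with hI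
  have hIpos : 0 < I := nn_int
  set c := min (1 / (10000 * B)) (I / (8 * Real.pi * B^2)) with hc
  have hcpos : 0 < c := by
    apply lt_min <;> positivity
  have hcB : c * B ≤ 1/10000 := by
    have : c ≤ 1 / (10000 * B) := min_le_left _ _
    calc c * B ≤ 1 / (10000 * B) * B := by gcongr
      _ = 1/10000 := by field_simp
  have hcI : c * (4 * Real.pi * B^2) ≤ I / 2 := by
    have : c ≤ I / (8 * Real.pi * B^2) := min_le_right _ _
    calc c * (4 * Real.pi * B^2) ≤ I / (8 * Real.pi * B^2) * (4 * Real.pi * B^2) := by gcongr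
      _ = I/2 := by field_simp; norm_num
  have hcd : ∀ t, |c * dd t| ≤ 1/10000 := fun t => by
    rw [abs_mul, abs_of_pos hcpos]
    exact (mul_le_mul_of_nonneg_left (hd t) hcpos.le).trans hcB
  have hD1 : ∀ t, 1/2 ≤ 1 + c * dd t := fun t => by linarith [(abs_le.1 (hcd t)).1]
  have hD2 : ∀ t, 1 + c * dd t ≤ 2 := fun t => by linarith [(abs_le.1 (hcd t)).2]
  have hDc : Continuous fun t => 1 + c * dd t := by have := dd_cont; fun_prop
  have hDi : Continuous fun t => (1 + c * dd t)⁻¹ :=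
    hDc.inv₀ (fun t => by linarith [hD1 t])
  have hq : Continuous fun t => nn t * (1 + c * dd t)⁻¹ := nn_cont.mul hDi
  set P := ∫ t in (0:ℝ)..(2 * Real.pi), (1 + c * dd t)⁻¹ with hP
  set Q := ∫ t in (0:ℝ)..(2 * Real.pi), nn t * (1 + c * dd t)⁻¹ with hQ
  have pi0 : (0:ℝ) ≤ 2 * Real.pi := by positivity
  have hi1 : ∀ t, (1 + c * dd t)⁻¹ ≤ 2 := fun t => by
    have := inv_anti₀ (by norm_num) (hD1 t); norm_num at this; linarith
  have hi2 : ∀ t, 1/2 ≤ (1 + c * dd t)⁻¹ := fun t => by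
    have := inv_anti₀ (by linarith [hD1 t]) (hD2 t); norm_num at this ⊢; linarith
  have hPlow : Real.pi ≤ P := by
    have := intervalIntegral.integral_mono_on (μ := MeasureTheory.volume) pi0
      (continuous_const (y := (1/2:ℝ)).intervalIntegrable 0 (2 * Real.pi))
      (hDi.intervalIntegrable 0 (2 * Real.pi)) (fun t _ => hi2 t)
    rw [intervalIntegral.integral_const] at this
    simp only [sub_zero, smul_eq_mul] at this
    linarith
  have hQup : Q ≤ 4 * Real.pi * B := by
    have := intervalIntegral.integral_mono_on (μ := MeasureTheory.volume) pi0
      (hq.intervalIntegrable 0 (2 * Real.pi))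
      (continuous_const (y := (2 * B:ℝ)).intervalIntegrable 0 (2 * Real.pi))
      (fun t _ => by
        have h1 := hi1 t; have h2 := hi2 t; have h3 := (abs_le.1 (hn t)).2
        nlinarith)
    rw [intervalIntegral.integral_const] at this
    simp only [sub_zero, smul_eq_mul] at this
    linarith
  have hQlow : I / 2 ≤ Q := by
    have := intervalIntegral.integral_mono_on (μ := MeasureTheory.volume) pi0
      ((nn_cont.sub (continuous_const (y := (2 * c * B^2:ℝ)))).intervalIntegrable 0 (2 * Real.pi))
      (hq.intervalIntegrable 0 (2 * Real.pi))
      (fun t _ => by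
        have hne : 1 + c * dd t ≠ 0 := by linarith [hD1 t]
        have e1 : nn t - nn t * (1 + c * dd t)⁻¹ = c * (nn t * dd t * (1 + c * dd t)⁻¹) := by
          field_simp; ring
        have e2 : nn t * dd t * (1 + c * dd t)⁻¹ ≤ B * B * 2 := by
          apply (le_abs_self _).trans
          rw [abs_mul, abs_mul, abs_of_nonneg (by linarith [hi2 t] : 0 ≤ (1 + c * dd t)⁻¹)]
          gcongr
          · linarith [hi2 t]
          · exact hn t
          · exact hd t
          · exact hi1 t
        have e3 := mul_le_mul_of_nonneg_left e2 hcpos.le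
        show nn t - 2 * c * B^2 ≤ _
        linarith)
    simp only [Pi.sub_apply] at this
    rw [intervalIntegral.integral_sub (nn_cont.intervalIntegrable _ _)
      (continuous_const.intervalIntegrable _ _), intervalIntegral.integral_const] at this
    simp only [sub_zero, smul_eq_mul] at this
    linarith
  have hPpos : 0 < P := Real.pi_pos.trans_le hPlow
  have hQpos : 0 < Q := by linarith
  refine ⟨c * Q / P, c, B, by positivity, hcpos, hBB, ?_, by linarith, ?_, hn, hd, ?_⟩
  · rw [div_le_iff₀ hPpos]
    have : c * Q ≤ c * (4 * Real.pi * B) := by gcongr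
    nlinarith [Real.pi_pos]
  · intro p hp
    obtain ⟨a, b, d⟩ := hW p hp
    exact ⟨a.trans (le_max_right _ _), b.trans (le_max_right _ _), d.trans (le_max_right _ _)⟩
  · have e : ∀ t, (c * nn t - c * Q / P) / (1 + c * dd t) =
        c * (nn t * (1 + c * dd t)⁻¹) - c * Q / P * (1 + c * dd t)⁻¹ := fun t => by
      rw [div_eq_mul_inv]; ring
    simp only [e]
    rw [intervalIntegral.integral_sub ((hq.const_mul c).intervalIntegrable _ _)
      ((hDi.const_mul _).intervalIntegrable _ _), intervalIntegral.integral_const_mul,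
      intervalIntegral.integral_const_mul, ← hP, ← hQ]
    field_simp
    ring

lemma exp_small {x : ℝ} (h : |x| ≤ 1/10) : 9/10 ≤ Real.exp x ∧ Real.exp x ≤ 10/9 := by
  obtain ⟨h1, h2⟩ := abs_le.1 h
  constructor
  · linarith [Real.add_one_le_exp x]
  · have h3 : 9/10 ≤ Real.exp (-x) := by linarith [Real.add_one_le_exp (-x)]
    have h4 : Real.exp x * Real.exp (-x) = 1 := by rw [← Real.exp_add]; simp
    nlinarith [Real.exp_pos x]

/-- There exists a `C^∞` function `f : [-1,1]² → ℝ` with a unique critical point at the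
origin, satisfying a two-sided PL condition with some constant `C`, and yet there is a
nonempty open set `U ⊆ [-1,1]²` such that every GDA flow started in `U` is a nonconstant
periodic trajectory. -/
theorem statement_0 :
    ∃ (f : ℝ × ℝ → ℝ) (C : ℝ),
      ContDiffOn ℝ (⊤ : ℕ∞) f Sq ∧
      (pdx f (0, 0) = 0 ∧ pdy f (0, 0) = 0) ∧
      (∀ p ∈ Sq, p ≠ (0, 0) → ¬(pdx f p = 0 ∧ pdy f p = 0)) ∧
      (∀ p ∈ Sq,
        f p - sInf ((fun x' => f (x', p.2)) '' Icc (-1 : ℝ) 1) ≤ C * (pdx f p) ^ 2 ∧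
        sSup ((fun y' => f (p.1, y')) '' Icc (-1 : ℝ) 1) - f p ≤ C * (pdy f p) ^ 2) ∧
      (∃ U : Set (ℝ × ℝ), U.Nonempty ∧ IsOpen U ∧ U ⊆ Sq ∧
        ∀ z₀ ∈ U, ∃ z : ℝ → ℝ × ℝ,
          z 0 = z₀ ∧
          (∀ t : ℝ, z t ∈ Sq ∧ HasDerivAt z (-(pdx f (z t)), pdy f (z t)) t) ∧
          (∃ T > 0, ∀ t : ℝ, z (t + T) = z t) ∧
          (∃ s t : ℝ, z s ≠ z t)) := by
  obtain ⟨e, c, B, he, hc, hB, he2, hcB, hW, hn, hd, hinteg⟩ := params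
  have hWx : ∀ p ∈ Sq, |c * pdx WW p| ≤ 1/1000 := fun p hp => by
    rw [abs_mul, abs_of_pos hc]
    exact (mul_le_mul_of_nonneg_left (hW p hp).2.1 hc.le).trans hcB
  have hWy : ∀ p ∈ Sq, |c * pdy WW p| ≤ 1/1000 := fun p hp => by
    rw [abs_mul, abs_of_pos hc]
    exact (mul_le_mul_of_nonneg_left (hW p hp).2.2 hc.le).trans hcB
  have hW0 : ∀ p ∈ Sq, |c * WW p| ≤ 1/1000 := fun p hp => by
    rw [abs_mul, abs_of_pos hc]
    exact (mul_le_mul_of_nonneg_left (hW p hp).1 hc.le).trans hcB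
  have hfx : ∀ p ∈ Sq, 1/8 < |p.2| → (1/16)^2 ≤ (pdx (ff e c) p)^2 := by
    rintro p hp h
    rw [pdx_ff]
    obtain ⟨a1, a2⟩ := abs_le.1 (hWx p hp)
    obtain ⟨⟨x1, x2⟩, ⟨y1, y2⟩⟩ := hp
    have b1 : e * p.1 ≤ 1/1000 := by nlinarith
    have b2 : -(1/1000) ≤ e * p.1 := by nlinarith
    rcases lt_abs.1 h with h | h <;> nlinarith
  have hfy : ∀ p ∈ Sq, 1/8 < |p.1| → (1/16)^2 ≤ (pdy (ff e c) p)^2 := by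
    rintro p hp h
    rw [pdy_ff]
    obtain ⟨a1, a2⟩ := abs_le.1 (hWy p hp)
    obtain ⟨⟨x1, x2⟩, ⟨y1, y2⟩⟩ := hp
    have b1 : e * p.2 ≤ 1/1000 := by nlinarith
    have b2 : -(1/1000) ≤ e * p.2 := by nlinarith
    rcases lt_abs.1 h with h | h <;> nlinarith
  have hf0 : ∀ p ∈ Sq, |ff e c p| ≤ 2 := by
    rintro p hp
    obtain ⟨a1, a2⟩ := abs_le.1 (hW0 p hp)
    obtain ⟨⟨x1, x2⟩, ⟨y1, y2⟩⟩ := hp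
    unfold ff
    have c1 : p.1^2 ≤ 1 := by nlinarith
    have c2 : p.2^2 ≤ 1 := by nlinarith
    have b1 : e * (p.1^2 - p.2^2) ≤ 1/1000 := by nlinarith [sq_nonneg p.1, sq_nonneg p.2]
    have b2 : -(1/1000) ≤ e * (p.1^2 - p.2^2) := by nlinarith [sq_nonneg p.1, sq_nonneg p.2]
    rw [abs_le]
    constructor <;> nlinarith [sq_nonneg (p.1 + p.2), sq_nonneg (p.1 - p.2)]
  have hCnn : 0 ≤ 1 / (2*e) := by positivity
  refine ⟨ff e c, 1024 + 1 / (2*e), ?_, ?_, ?_, ?_, ?_⟩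
  · have h1 := WW_contDiff
    apply ContDiff.contDiffOn
    unfold ff
    fun_prop
  · rw [pdx_ff, pdy_ff, pdx_WW_zero (by simp), pdy_WW_zero (by simp)]
    simp
  · rintro p hp hne ⟨h1, h2⟩
    have hy : |p.2| ≤ 1/8 := by
      by_contra h
      have := hfx p hp (not_le.1 h)
      rw [h1] at this; norm_num at this
    have hx : |p.1| ≤ 1/8 := by
      by_contra h
      have := hfy p hp (not_le.1 h)
      rw [h2] at this; norm_num at this
    rw [pdx_ff, pdx_WW_zero hy] at h1
    rw [pdy_ff, pdy_WW_zero hx] at h2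
    apply hne
    have ey : p.2 * (1 + e^2) = 0 := by linear_combination h1 - e * h2
    have ey : p.2 = 0 := by
      rcases mul_eq_zero.1 ey with h | h
      · exact h
      · nlinarith
    have ex : p.1 = 0 := by rw [ey] at h2; linarith
    exact Prod.ext ex ey
  · intro p hp
    constructor
    · have : ff e c p - (1024 + 1 / (2*e)) * (pdx (ff e c) p)^2 ≤
          sInf ((fun x' => ff e c (x', p.2)) '' Icc (-1 : ℝ) 1) := by
        apply le_csInf
        · exact ⟨_, 0, by norm_num, rfl⟩
        · rintro _ ⟨x', hx', rfl⟩
          by_cases hy : |p.2| ≤ 1/8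
          · have e1 : pdx (ff e c) p = p.2 + e * p.1 := by rw [pdx_ff, pdx_WW_zero hy]; ring
            have e2 : ff e c p = p.1 * p.2 + e * (p.1^2 - p.2^2) / 2 := by
              unfold ff; rw [WW_zero (Or.inr hy)]; ring
            have e3 : ff e c (x', p.2) = x' * p.2 + e * (x'^2 - p.2^2) / 2 := by
              unfold ff; rw [WW_zero (p := (x', p.2)) (Or.inr hy)]; ring
            simp only [e1, e2, e3]
            have e4 : x' * p.2 + e * (x'^2 - p.2^2) / 2 - (p.1 * p.2 + e * (p.1^2 - p.2^2) / 2)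
                + 1 / (2*e) * (p.2 + e * p.1)^2 = (p.2 + e * x')^2 / (2*e) := by
              field_simp; ring
            have e5 : 0 ≤ (p.2 + e * x')^2 / (2*e) := by positivity
            nlinarith [sq_nonneg (p.2 + e * p.1)]
          · have h1 := hfx p hp (not_le.1 hy)
            have h2 := (abs_le.1 (hf0 p hp)).2
            have h3 := (abs_le.1 (hf0 (x', p.2) ⟨hx', hp.2⟩)).1
            have h4 := mul_nonneg hCnn (sq_nonneg (pdx (ff e c) p))
            simp only
            linarith
      linarith
    · have : sSup ((fun y' => ff e c (p.1, y')) '' Icc (-1 : ℝ) 1) ≤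
          ff e c p + (1024 + 1 / (2*e)) * (pdy (ff e c) p)^2 := by
        apply csSup_le
        · exact ⟨_, 0, by norm_num, rfl⟩
        · rintro _ ⟨y', hy', rfl⟩
          by_cases hx : |p.1| ≤ 1/8
          · have e1 : pdy (ff e c) p = p.1 - e * p.2 := by rw [pdy_ff, pdy_WW_zero hx]; ring
            have e2 : ff e c p = p.1 * p.2 + e * (p.1^2 - p.2^2) / 2 := by
              unfold ff; rw [WW_zero (Or.inl hx)]; ring
            have e3 : ff e c (p.1, y') = p.1 * y' + e * (p.1^2 - y'^2) / 2 := by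
              unfold ff; rw [WW_zero (p := (p.1, y')) (Or.inl hx)]; ring
            simp only [e1, e2, e3]
            have e4 : (p.1 * p.2 + e * (p.1^2 - p.2^2) / 2) - (p.1 * y' + e * (p.1^2 - y'^2) / 2)
                + 1 / (2*e) * (p.1 - e * p.2)^2 = (p.1 - e * y')^2 / (2*e) := by
              field_simp; ring
            have e5 : 0 ≤ (p.1 - e * y')^2 / (2*e) := by positivity
            nlinarith [sq_nonneg (p.1 - e * p.2)]
          · have h1 := hfy p hp (not_le.1 hx)
            have h2 := (abs_le.1 (hf0 p hp)).1
            have h3 := (abs_le.1 (hf0 (p.1, y') ⟨hp.1, hy'⟩)).2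
            have h4 := mul_nonneg hCnn (sq_nonneg (pdy (ff e c) p))
            simp only
            linarith
      linarith
  · -- dynamics
    have hcd : ∀ t, |c * dd t| ≤ 1/1000 := fun t => by
      rw [abs_mul, abs_of_pos hc]
      exact (mul_le_mul_of_nonneg_left (hd t) hc.le).trans hcB
    have hcn : ∀ t, |c * nn t| ≤ 1/1000 := fun t => by
      rw [abs_mul, abs_of_pos hc]
      exact (mul_le_mul_of_nonneg_left (hn t) hc.le).trans hcB
    have hD1 : ∀ t, 1/2 ≤ 1 + c * dd t := fun t => by linarith [(abs_le.1 (hcd t)).1]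
    have hD2 : ∀ t, 1 + c * dd t ≤ 2 := fun t => by linarith [(abs_le.1 (hcd t)).2]
    have hDc : Continuous fun t => 1 + c * dd t := by have := dd_cont; fun_prop
    have hDp : Function.Periodic (fun t => 1 + c * dd t) (2 * Real.pi) := fun t => by
      simp only [dd_per t]
    obtain ⟨Θ, T, hT, hΘp, hΘd, hΘs⟩ := clock _ hDc hD1 hD2 hDp
    have hqc : Continuous fun t => (c * nn t - e) / (1 + c * dd t) := by
      have := nn_cont
      exact (by fun_prop : Continuous fun t => c * nn t - e).div hDc
        (fun t => by linarith [hD1 t])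
    have hqp : Function.Periodic (fun t => (c * nn t - e) / (1 + c * dd t)) (2 * Real.pi) :=
      fun t => by simp only [dd_per t, nn_per t]
    obtain ⟨g, hg⟩ : ∃ g : ℝ → ℝ, g = fun u => ∫ t in (0:ℝ)..u, (c * nn t - e) / (1 + c * dd t) :=
      ⟨_, rfl⟩
    have hgd : ∀ u, HasDerivAt g ((c * nn u - e) / (1 + c * dd u)) u := fun u => by
      rw [hg]; exact (hqc.integral_hasStrictDerivAt 0 u).hasDerivAt
    have hgp : Function.Periodic g (2 * Real.pi) := fun u => by
      have e1 := hqp.intervalIntegral_add_eq u 0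
      rw [zero_add, hinteg] at e1
      simp only [hg]
      rw [← intervalIntegral.integral_add_adjacent_intervals
        (hqc.intervalIntegrable 0 u) (hqc.intervalIntegrable u _), e1, add_zero]
    have hgb : ∀ u, |g u| ≤ 1/20 := by
      intro u
      obtain ⟨s, hs, es⟩ := hgp.exists_mem_Ico₀ (by positivity) u
      rw [es, hg]
      have := intervalIntegral.norm_integral_le_of_norm_le_const (a := 0) (b := s) (C := 1/250)
        (f := fun t => (c * nn t - e) / (1 + c * dd t)) (fun t _ => by
          rw [Real.norm_eq_abs, abs_div, div_le_iff₀ (by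
            rw [abs_of_pos] <;> linarith [hD1 t]), abs_of_pos (by linarith [hD1 t] : 0 < 1 + c * dd t)]
          obtain ⟨a1, a2⟩ := abs_le.1 (hcn t)
          have : |c * nn t - e| ≤ 2/1000 := by rw [abs_le]; constructor <;> linarith
          linarith [hD1 t])
      rw [Real.norm_eq_abs, sub_zero, abs_of_nonneg hs.1] at this
      have h4 := Real.pi_lt_four
      have := hs.2
      simp only
      linarith
    refine ⟨{p | 49/100 < p.1^2 + p.2^2 ∧ p.1^2 + p.2^2 < 64/100}, ⟨(3/4, 0), ?_⟩, ?_, ?_, ?_⟩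
    · constructor <;> norm_num
    · have hcont : Continuous fun p : ℝ × ℝ => p.1^2 + p.2^2 := by fun_prop
      exact (isOpen_lt continuous_const hcont).inter (isOpen_lt hcont continuous_const)
    · rintro p ⟨_, h⟩
      refine ⟨⟨?_, ?_⟩, ⟨?_, ?_⟩⟩ <;> nlinarith [sq_nonneg p.1, sq_nonneg p.2]
    · rintro z₀ ⟨hz1, hz2⟩
      obtain ⟨R, θ₀, hR, hx0, hy0⟩ : ∃ R θ₀ : ℝ, 0 ≤ R ∧ z₀.1 = R * Real.cos θ₀ ∧
          z₀.2 = R * Real.sin θ₀ := by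
        refine ⟨‖(⟨z₀.1, z₀.2⟩ : ℂ)‖, (⟨z₀.1, z₀.2⟩ : ℂ).arg, norm_nonneg _, ?_, ?_⟩
        · rw [Complex.norm_mul_cos_arg]
        · rw [Complex.norm_mul_sin_arg]
      have hRR : z₀.1^2 + z₀.2^2 = R^2 := by
        rw [hx0, hy0]
        have := Real.sin_sq_add_cos_sq θ₀; linear_combination R^2 * this
      rw [hRR] at hz1 hz2
      have hR1 : 7/10 < R := by nlinarith
      have hR2 : R < 8/10 := by nlinarith
      obtain ⟨t₀, ht₀⟩ := hΘs θ₀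
      obtain ⟨r, hr⟩ : ∃ r : ℝ → ℝ, r = fun u => R * Real.exp (g u - g θ₀) := ⟨_, rfl⟩
      have hrb : ∀ u, 1/2 < r u ∧ r u < 1 := fun u => by
        have h1 : |g u - g θ₀| ≤ 1/10 := by
          have a := abs_le.1 (hgb u); have b := abs_le.1 (hgb θ₀)
          rw [abs_le]; constructor <;> linarith
        obtain ⟨h2, h3⟩ := exp_small h1
        simp only [hr]
        constructor <;> nlinarith
      have hrd : ∀ u, HasDerivAt r (r u * ((c * nn u - e) / (1 + c * dd u))) u := fun u => by
        rw [hr]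
        refine ((((hgd u).sub_const (g θ₀)).exp).const_mul R).congr_deriv ?_
        beta_reduce
        ring
      have hrp : ∀ u, r (u + 2 * Real.pi) = r u := fun u => by simp only [hr, hgp u]
      refine ⟨fun t => (r (Θ (t + t₀)) * Real.cos (Θ (t + t₀)),
        r (Θ (t + t₀)) * Real.sin (Θ (t + t₀))), ?_, ?_, ⟨T, hT, ?_⟩, ?_⟩
      · simp only [zero_add, ht₀, hr, sub_self, Real.exp_zero, mul_one]
        exact Prod.ext hx0.symm hy0.symm
      · intro t
        obtain ⟨u, hu⟩ : ∃ u, u = Θ (t + t₀) := ⟨_, rfl⟩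
        obtain ⟨r1, r2⟩ := hrb u
        constructor
        · simp only [← hu]
          have := Real.sin_sq_add_cos_sq u
          have a1 := Real.cos_le_one u; have a2 := Real.neg_one_le_cos u
          have a3 := Real.sin_le_one u; have a4 := Real.neg_one_le_sin u
          refine ⟨⟨?_, ?_⟩, ⟨?_, ?_⟩⟩ <;> simp only <;> nlinarith
        · have hΘ' : HasDerivAt (fun t => Θ (t + t₀)) (1 + c * dd u) t := by
            have := (hΘd (t + t₀)).comp_add_const t t₀
            rwa [← hu] at this
          have hne : 1 + c * dd u ≠ 0 := by linarith [hD1 u]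
          have h1 : HasDerivAt (fun t => r (Θ (t + t₀))) (r u * (c * nn u - e)) t := by
            have h := hrd u
            rw [hu] at h
            have := HasDerivAt.comp t h hΘ'
            rw [← hu] at this
            refine this.congr_deriv ?_
            field_simp
          have h2 : HasDerivAt (fun t => Real.cos (Θ (t + t₀)))
              (-Real.sin u * (1 + c * dd u)) t := by rw [hu] at hΘ' ⊢; exact hΘ'.cos
          have h3 : HasDerivAt (fun t => Real.sin (Θ (t + t₀)))
              (Real.cos u * (1 + c * dd u)) t := by rw [hu] at hΘ' ⊢; exact hΘ'.sin
          have h4 := (h1.mul h2).prodMk (h1.mul h3)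
          simp only [← hu] at h4 ⊢
          rw [polar_x r1, polar_y r1]
          refine HasDerivAt.congr_deriv h4 ?_
          refine Prod.ext ?_ ?_ <;> simp only <;> ring
      · intro t
        have e0 : t + T + t₀ = t + t₀ + T := by ring
        simp only [e0, hΘp, hrp, Real.cos_add_two_pi, Real.sin_add_two_pi]
      · obtain ⟨s1, hs1⟩ := hΘs 0
        obtain ⟨s2, hs2⟩ := hΘs Real.pi
        refine ⟨s1 - t₀, s2 - t₀, fun h => ?_⟩
        have h := congrArg Prod.fst h
        simp only [sub_add_cancel, hs1, hs2, Real.cos_zero, Real.cos_pi] at h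
        linarith [(hrb 0).1, (hrb Real.pi).1]
end

section
/- Let (M(t))_{t∈I} be a complete flow line of the vector field v, i.e. a maximal solution of M'(t) = v(M(t)). Then exactly one of the following four possibilities holds: (0) M(t) = (0,0) for all t ∈ I; (1) there is exactly one time t ∈ I at which M(t) ∈ X; (2) M(t) ∉ X for all t ∈ I and M(t) → (0,0) as t → +∞; (3) M(t) ∉ X for all t ∈ I and M(t) → (0,0) as t → −∞. -/
open Set Filter

/-- The vector field `v(x,y) = ((γy - x) φ(x² + axy + by²), (y + γx) φ(y² - axy + bx²))`,
with `a = γ + 1` and `b = γ² + γ + 1`. -/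
def vf (γ : ℝ) (φ : ℝ → ℝ) (p : ℝ × ℝ) : ℝ × ℝ :=
  ((γ * p.2 - p.1) * φ (p.1 ^ 2 + (γ + 1) * p.1 * p.2 + (γ ^ 2 + γ + 1) * p.2 ^ 2),
   (p.2 + γ * p.1) * φ (p.2 ^ 2 - (γ + 1) * p.1 * p.2 + (γ ^ 2 + γ + 1) * p.1 ^ 2))

/-- The set `X = {(x,y) : x = γy or y = -γx}`. -/
def Xset (γ : ℝ) : Set (ℝ × ℝ) := {p | p.1 = γ * p.2 ∨ p.2 = -γ * p.1}

/-- `M` solves `M' = V(M)` on `I`. -/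
def IsFlow (V : ℝ × ℝ → ℝ × ℝ) (I : Set ℝ) (M : ℝ → ℝ × ℝ) : Prop :=
  ∀ t ∈ I, HasDerivWithinAt M (V (M t)) I t

/-- `M` on `I` cannot be extended. -/
def IsMaxl (V : ℝ × ℝ → ℝ × ℝ) (I : Set ℝ) (M : ℝ → ℝ × ℝ) : Prop :=
  ∀ J : Set ℝ, J.OrdConnected → I ⊆ J → ∀ N : ℝ → ℝ × ℝ,
      (∀ t ∈ I, N t = M t) → IsFlow V J N → J ⊆ I

theorem IsFlow.mono {V : ℝ × ℝ → ℝ × ℝ} {I J : Set ℝ} {M : ℝ → ℝ × ℝ} (h : IsFlow V I M)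
    (hJ : J ⊆ I) : IsFlow V J M := fun t ht => (h t (hJ ht)).mono hJ

theorem IsFlow.cont {V : ℝ × ℝ → ℝ × ℝ} {I : Set ℝ} {M : ℝ → ℝ × ℝ} (h : IsFlow V I M) :
    ContinuousOn M I := fun t ht => (h t ht).continuousWithinAt

theorem lip_ball {V : ℝ × ℝ → ℝ × ℝ} (hV : ContDiff ℝ 1 V) (R : ℝ) :
    ∃ K, LipschitzOnWith K V (Metric.closedBall 0 R) :=
  LocallyLipschitzOn.exists_lipschitzOnWith_of_compact (isCompact_closedBall _ _)
    hV.locallyLipschitz.locallyLipschitzOn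

theorem bdd_pair {f g : ℝ → ℝ × ℝ} {a b : ℝ} (hf : ContinuousOn f (Icc a b))
    (hg : ContinuousOn g (Icc a b)) :
    ∃ R, ∀ t ∈ Icc a b, f t ∈ Metric.closedBall (0 : ℝ × ℝ) R ∧
      g t ∈ Metric.closedBall (0 : ℝ × ℝ) R := by
  obtain ⟨C, hC⟩ := isCompact_Icc.exists_bound_of_continuousOn hf
  obtain ⟨D, hD⟩ := isCompact_Icc.exists_bound_of_continuousOn hg
  refine ⟨max C D, fun t ht => ⟨?_, ?_⟩⟩
  · simpa only [mem_closedBall_zero_iff] using (hC t ht).trans (le_max_left _ _)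
  · simpa only [mem_closedBall_zero_iff] using (hD t ht).trans (le_max_right _ _)

theorem uniq_right {V : ℝ × ℝ → ℝ × ℝ} (hV : ContDiff ℝ 1 V) {a b : ℝ} {f g : ℝ → ℝ × ℝ}
    (hf : IsFlow V (Icc a b) f) (hg : IsFlow V (Icc a b) g) (h : f a = g a) :
    EqOn f g (Icc a b) := by
  obtain ⟨R, hR⟩ := bdd_pair hf.cont hg.cont
  obtain ⟨K, hK⟩ := lip_ball hV R
  have key : ∀ k : ℝ → ℝ × ℝ, IsFlow V (Icc a b) k → ∀ t ∈ Ico a b,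
      HasDerivWithinAt k (V (k t)) (Ici t) t := fun k hk t ht =>
    (hk t ⟨ht.1, ht.2.le⟩).mono_of_mem_nhdsWithin
      (mem_of_superset (Icc_mem_nhdsGE ht.2) (Icc_subset_Icc_left ht.1))
  exact ODE_solution_unique_of_mem_Icc_right (v := fun _ => V)
    (s := fun _ => Metric.closedBall 0 R) (fun _ _ => hK) hf.cont (key f hf)
    (fun t ht => (hR t ⟨ht.1, ht.2.le⟩).1) hg.cont (key g hg)
    (fun t ht => (hR t ⟨ht.1, ht.2.le⟩).2) h

theorem uniq_left {V : ℝ × ℝ → ℝ × ℝ} (hV : ContDiff ℝ 1 V) {a b : ℝ} {f g : ℝ → ℝ × ℝ}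
    (hf : IsFlow V (Icc a b) f) (hg : IsFlow V (Icc a b) g) (h : f b = g b) :
    EqOn f g (Icc a b) := by
  obtain ⟨R, hR⟩ := bdd_pair hf.cont hg.cont
  obtain ⟨K, hK⟩ := lip_ball hV R
  have key : ∀ k : ℝ → ℝ × ℝ, IsFlow V (Icc a b) k → ∀ t ∈ Ioc a b,
      HasDerivWithinAt k (V (k t)) (Iic t) t := fun k hk t ht =>
    (hk t ⟨ht.1.le, ht.2⟩).mono_of_mem_nhdsWithin
      (mem_of_superset (Icc_mem_nhdsLE ht.1) (Icc_subset_Icc_right ht.2))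
  exact ODE_solution_unique_of_mem_Icc_left (v := fun _ => V)
    (s := fun _ => Metric.closedBall 0 R) (fun _ _ => hK) hf.cont (key f hf)
    (fun t ht => (hR t ⟨ht.1.le, ht.2⟩).1) hg.cont (key g hg)
    (fun t ht => (hR t ⟨ht.1.le, ht.2⟩).2) h

/-- A flow line through a zero of `V` is constant. -/
theorem zero_of_zero {V : ℝ × ℝ → ℝ × ℝ} (hV : ContDiff ℝ 1 V) (hV0 : V 0 = 0) {I : Set ℝ}
    (hI : I.OrdConnected) {M : ℝ → ℝ × ℝ} (hM : IsFlow V I M) {s : ℝ} (hs : s ∈ I)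
    (h0 : M s = 0) : ∀ t ∈ I, M t = 0 := by
  have hz : ∀ J, IsFlow V J (fun _ => 0) := fun J t _ => by
    simpa [hV0] using hasDerivWithinAt_const t J (0 : ℝ × ℝ)
  intro t ht
  rcases le_total s t with h | h
  · exact uniq_right hV (hM.mono (hI.out hs ht)) (hz _) h0 ⟨h, le_rfl⟩
  · exact uniq_left hV (hM.mono (hI.out ht hs)) (hz _) h0 ⟨le_rfl, h⟩

/-- A maximal flow line bounded in forward time exists for all forward times. -/
theorem unbdd_of_bdd {V : ℝ × ℝ → ℝ × ℝ} (hV : ContDiff ℝ 1 V) {I : Set ℝ}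
    (hI : I.OrdConnected) {M : ℝ → ℝ × ℝ} (hM : IsFlow V I M) (hmax : IsMaxl V I M)
    {t0 : ℝ} (ht0 : t0 ∈ I) {R : ℝ} (hR : ∀ t ∈ I, t0 ≤ t → ‖M t‖ ≤ R) : ¬ BddAbove I := by
  intro hb
  obtain ⟨K, hK⟩ := lip_ball hV (R + 1)
  obtain ⟨C, hC⟩ := (isCompact_closedBall (0 : ℝ × ℝ) (R + 1)).exists_bound_of_continuousOn
    hV.continuous.continuousOn
  set L : NNReal := ⟨max C 0, le_max_right _ _⟩ with hL
  have hL0 : (0 : ℝ) ≤ L := L.2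
  set ε : ℝ := 1 / ((L : ℝ) + 1) with hε
  have hεpos : 0 < ε := by positivity
  have hLε : (L : ℝ) * ε ≤ 1 := by
    rw [hε, mul_one_div, div_le_one (by positivity)]; linarith
  set T := sSup I with hT
  have hTle : ∀ t ∈ I, t ≤ T := fun t ht => le_csSup hb ht
  obtain ⟨s, hs, hsT, hs0⟩ : ∃ s ∈ I, T - ε < s ∧ t0 ≤ s := by
    obtain ⟨s, hs, hs'⟩ := exists_lt_of_lt_csSup ⟨t0, ht0⟩ (show T - ε < sSup I by linarith)
    rcases le_total s t0 with h | h
    · exact ⟨t0, ht0, by linarith, le_rfl⟩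
    · exact ⟨s, hs, hs', h⟩
  have hsub : Metric.closedBall (M s) ((1 : NNReal) : ℝ) ⊆ Metric.closedBall 0 (R + 1) := by
    intro p hp
    have h1 := hR s hs hs0
    rw [Metric.mem_closedBall, dist_eq_norm] at hp
    rw [mem_closedBall_zero_iff]
    have := norm_add_le (p - M s) (M s)
    simp only [sub_add_cancel, NNReal.coe_one] at *
    linarith
  have hsmem : s ∈ Icc s (s + ε) := ⟨le_rfl, by linarith⟩
  have hPL : IsPicardLindelof (fun _ => V) (⟨s, hsmem⟩ : Icc s (s + ε)) (M s) 1 0 L K := by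
    apply IsPicardLindelof.of_time_independent
    · intro x hx
      exact (hC x (hsub hx)).trans (le_max_left _ _)
    · exact hK.mono hsub
    · simp [hεpos.le, hLε]
  obtain ⟨α, hα0, hα⟩ := hPL.exists_eq_forall_mem_Icc_hasDerivWithinAt₀
  have hα0 : α s = M s := hα0
  have hα : IsFlow V (Icc s (s + ε)) α := hα
  have hIcc : ∀ t ∈ I, s ≤ t → t ∈ Icc s (s + ε) := fun t ht h =>
    ⟨h, by have := hTle t ht; linarith⟩
  have heq : ∀ t ∈ I, s ≤ t → α t = M t := by
    intro t ht h
    exact uniq_right hV (hα.mono (Icc_subset_Icc_right (hIcc t ht h).2))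
      (hM.mono (hI.out hs ht)) hα0 ⟨h, le_rfl⟩
  classical
  set N : ℝ → ℝ × ℝ := fun t => if t ≤ s then M t else α t with hN
  have hN1 : ∀ t, t ≤ s → N t = M t := fun t ht => by simp [hN, ht]
  have hN2 : ∀ t, s ≤ t → N t = α t := fun t ht => by
    rcases ht.eq_or_lt with rfl | h
    · rw [hN1 _ le_rfl, hα0]
    · simp [hN, not_le.2 h]
  have hNM : ∀ t ∈ I, N t = M t := by
    intro t ht
    rcases le_total t s with h | h
    · exact hN1 t h
    · rw [hN2 t h, heq t ht h]
  set J := (I ∩ Iic s) ∪ Icc s (s + ε) with hJ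
  have hIJ : I ⊆ J := fun t ht => by
    rcases le_total t s with h | h
    · exact Or.inl ⟨ht, h⟩
    · exact Or.inr (hIcc t ht h)
  have hJord : J.OrdConnected := by
    refine ⟨fun x hx y hy z hz => ?_⟩
    rcases le_total s z with h | h
    · refine Or.inr ⟨h, hz.2.trans ?_⟩
      rcases hy with hy | hy
      · have : y ≤ s := hy.2
        linarith
      · exact hy.2
    · refine Or.inl ⟨?_, h⟩
      rcases hx with hx | hx
      · exact hI.out hx.1 hs ⟨hz.1, h⟩
      · have : z = s := le_antisymm h (hx.1.trans hz.1)
        rwa [this]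
  have hNflow : IsFlow V J N := by
    intro t ht
    apply HasDerivWithinAt.union
    · by_cases h : t ≤ s
      · have htI : t ∈ I := by
          rcases ht with ht | ht
          · exact ht.1
          · rwa [le_antisymm h ht.1]
        rw [hN1 t h]
        exact ((hM t htI).mono inter_subset_left).congr (fun x hx => hN1 x hx.2) (hN1 t h)
      · refine HasFDerivWithinAt.of_notMem_closure fun hc => h ?_
        exact (closure_minimal inter_subset_right isClosed_Iic hc)
    · by_cases h : s ≤ t
      · have htI : t ∈ Icc s (s + ε) := by
          rcases ht with ht | ht
          · exact ⟨h, le_trans ht.2 (by linarith)⟩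
          · exact ht
        rw [hN2 t h]
        exact (hα t htI).congr (fun x hx => hN2 x hx.1) (hN2 t h)
      · refine HasFDerivWithinAt.of_notMem_closure fun hc => h ?_
        rw [isClosed_Icc.closure_eq] at hc
        exact hc.1
  have := hmax J hJord hIJ N hNM hNflow (Or.inr ⟨by linarith, le_rfl⟩ : s + ε ∈ J)
  have := hTle _ this
  linarith

/-- If `h' < 0` at each zero of `h` then `h` can cross zero only once. -/
theorem neg_after {h h' : ℝ → ℝ} {a b : ℝ} (hab : a < b)
    (hd : ∀ t ∈ Icc a b, HasDerivWithinAt h (h' t) (Icc a b) t)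
    (hz : ∀ t ∈ Icc a b, h t = 0 → h' t < 0) (ha : h a ≤ 0) : h b < 0 := by
  have hle : ∀ t ∈ Icc a b, h t ≤ 0 := by
    intro t ht
    refine image_le_of_deriv_right_lt_deriv_boundary' (f := h) (f' := h') (B := fun _ => 0)
      (B' := fun _ => 0) (fun t ht => (hd t ht).continuousWithinAt) ?_ ha continuousOn_const
      (fun t _ => hasDerivWithinAt_const _ _ _) ?_ ht
    · intro t ht
      exact (hd t ⟨ht.1, ht.2.le⟩).mono_of_mem_nhdsWithin
        (mem_of_superset (Icc_mem_nhdsGE ht.2) (Icc_subset_Icc_left ht.1))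
    · intro t ht h0
      exact hz t ⟨ht.1, ht.2.le⟩ h0
  have hbm : b ∈ Icc a b := ⟨hab.le, le_rfl⟩
  refine lt_of_le_of_ne (hle b hbm) fun h0 => ?_
  have h1 := hz b hbm h0
  have h2 := (hd b hbm).mono_of_mem_nhdsWithin (Icc_mem_nhdsLE hab) |>.mono Iio_subset_Iic_self
  rw [hasDerivWithinAt_iff_tendsto_slope' (by simp)] at h2
  refine absurd (ge_of_tendsto h2 ?_) (not_le.2 h1)
  filter_upwards [Ioo_mem_nhdsLT hab] with t ht
  rw [slope_def_field, h0, sub_zero]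
  exact div_nonneg_of_nonpos (hle t ⟨ht.1.le, ht.2.le⟩) (by linarith [ht.2])

/-- A nonvanishing continuous function on an interval has constant sign. -/
theorem const_sign {h : ℝ → ℝ} {I : Set ℝ} (hI : I.OrdConnected) (hc : ContinuousOn h I)
    (hz : ∀ t ∈ I, h t ≠ 0) : (∀ t ∈ I, 0 < h t) ∨ (∀ t ∈ I, h t < 0) := by
  by_contra hcon
  push Not at hcon
  obtain ⟨⟨s, hs, h1⟩, ⟨t, ht, h2⟩⟩ := hcon
  obtain ⟨r, hr, h0⟩ := hI.isPreconnected.intermediate_value hs ht hc ⟨h1, h2⟩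
  exact hz r hr h0

/-- If a differentiable function and its derivative converge at infinity, the derivative tends
to zero. -/
theorem deriv_lim_zero {f f' : ℝ → ℝ} {t0 l c : ℝ} (hd : ∀ t, t0 < t → HasDerivAt f (f' t) t)
    (hf : Tendsto f atTop (nhds l)) (hf' : Tendsto f' atTop (nhds c)) : c = 0 := by
  have hex : ∀ t : ℝ, ∃ s, t ≤ s ∧ (t0 < t → f' s = f (t + 1) - f t) := by
    intro t
    by_cases ht : t0 < t
    · obtain ⟨s, hs, h⟩ := exists_hasDerivAt_eq_slope f f' (show t < t + 1 by linarith)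
        (fun x hx => (hd x (ht.trans_le hx.1)).continuousAt.continuousWithinAt)
        (fun x hx => hd x (ht.trans hx.1))
      exact ⟨s, hs.1.le, fun _ => by rw [h]; simp⟩
    · exact ⟨t, le_rfl, fun h => absurd h ht⟩
  choose s hs hs' using hex
  have h1 : Tendsto (fun t => f' (s t)) atTop (nhds c) :=
    hf'.comp (tendsto_atTop_mono hs tendsto_id)
  have h2 : Tendsto (fun t => f (t + 1) - f t) atTop (nhds (l - l)) :=
    (hf.comp (tendsto_atTop_add_const_right _ _ tendsto_id)).sub hf
  rw [sub_self] at h2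
  refine tendsto_nhds_unique (h1.congr' ?_) h2
  filter_upwards [eventually_gt_atTop t0] with t ht using hs' t ht

theorem gamma_pos {γ : ℝ} (hγ : γ ^ 3 + γ ^ 2 + γ - 1 / 3 = 0) : 0 < γ := by
  have h : γ * (γ ^ 2 + γ + 1) = 1 / 3 := by linarith
  have h2 : 0 < γ ^ 2 + γ + 1 := by nlinarith [sq_nonneg (γ + 1 / 2)]
  by_contra hc
  nlinarith [mul_nonneg (neg_nonneg.2 (not_lt.1 hc)) h2.le]

theorem quad_nonneg (γ x y : ℝ) :
    0 ≤ x ^ 2 + (γ + 1) * x * y + (γ ^ 2 + γ + 1) * y ^ 2 := by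
  nlinarith [sq_nonneg (x + (γ + 1) / 2 * y), mul_nonneg (sq_nonneg y)
    (show 0 ≤ 3 * γ ^ 2 + 2 * γ + 3 by nlinarith [sq_nonneg (γ + 1)])]

theorem quad_nonneg' (γ x y : ℝ) :
    0 ≤ x ^ 2 - (γ + 1) * y * x + (γ ^ 2 + γ + 1) * y ^ 2 := by
  have := quad_nonneg γ x (-y)
  nlinarith

theorem vf_contDiff (γ : ℝ) {φ : ℝ → ℝ} (hφ : ContDiffOn ℝ (⊤ : ℕ∞) φ (Ici 0)) :
    ContDiff ℝ 1 (vf γ φ) := by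
  have hφ1 : ContDiffOn ℝ 1 φ (Ici 0) := hφ.of_le (by exact_mod_cast le_top)
  rw [← contDiffOn_univ]
  unfold vf
  refine ContDiffOn.prodMk (ContDiffOn.mul ?_ (hφ1.comp ?_ ?_))
    (ContDiffOn.mul ?_ (hφ1.comp ?_ ?_))
  · exact ContDiff.contDiffOn (by fun_prop)
  · exact ContDiff.contDiffOn (by fun_prop)
  · intro p _
    exact quad_nonneg γ p.1 p.2
  · exact ContDiff.contDiffOn (by fun_prop)
  · exact ContDiff.contDiffOn (by fun_prop)
  · intro p _
    exact quad_nonneg' γ p.2 p.1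

/-- The two coordinates of the vector field with positive factors. -/
theorem vf_form (γ : ℝ) {φ : ℝ → ℝ} (hφone : ∀ t ∈ Ici (0 : ℝ), 1 ≤ φ t) (p : ℝ × ℝ) :
    ∃ f g : ℝ, 0 < f ∧ 0 < g ∧ (vf γ φ p).1 = -(p.1 - γ * p.2) * f ∧
      (vf γ φ p).2 = (p.2 + γ * p.1) * g := by
  refine ⟨_, _, lt_of_lt_of_le one_pos (hφone _ (quad_nonneg γ p.1 p.2)),
    lt_of_lt_of_le one_pos (hφone _ (quad_nonneg' γ p.2 p.1)), ?_, ?_⟩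
  · simp only [vf]; ring
  · simp only [vf]

theorem vf_zero (γ : ℝ) (φ : ℝ → ℝ) : vf γ φ 0 = 0 := by simp [vf]

theorem vf_neg (γ : ℝ) (φ : ℝ → ℝ) (p : ℝ × ℝ) : vf γ φ (-p) = -vf γ φ p := by
  ext <;> simp only [vf, Prod.fst_neg, Prod.snd_neg] <;> ring_nf

/-- Rotation by a quarter turn. -/
def rot (p : ℝ × ℝ) : ℝ × ℝ := (-p.2, p.1)

/-- Inverse rotation. -/
def rotInv (p : ℝ × ℝ) : ℝ × ℝ := (p.2, -p.1)

theorem vf_rot (γ : ℝ) (φ : ℝ → ℝ) (p : ℝ × ℝ) : vf γ φ (rot p) = -rot (vf γ φ p) := by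
  ext <;> simp only [vf, rot, Prod.fst_neg, Prod.snd_neg] <;> ring_nf

theorem vf_rotInv (γ : ℝ) (φ : ℝ → ℝ) (p : ℝ × ℝ) :
    vf γ φ (rotInv p) = -rotInv (vf γ φ p) := by
  ext <;> simp only [vf, rotInv, Prod.fst_neg, Prod.snd_neg] <;> ring_nf

theorem rev_aux {A : ℝ × ℝ → ℝ × ℝ} (hA : A = rot ∨ A = rotInv) {γ : ℝ} {φ : ℝ → ℝ}
    {I : Set ℝ} {M : ℝ → ℝ × ℝ} (hM : IsFlow (vf γ φ) I M) :
    IsFlow (vf γ φ) (-I) (fun t => A (M (-t))) := by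
  intro t ht
  have h1 : HasDerivWithinAt (fun t => M (-t)) ((-1 : ℝ) • vf γ φ (M (-t))) (-I) t :=
    HasDerivWithinAt.scomp t (hM (-t) ht) (hasDerivWithinAt_neg t (-I)) (fun x hx => hx)
  have hx : HasDerivWithinAt (fun t => (M (-t)).1) (-(vf γ φ (M (-t))).1) (-I) t := by
    rw [neg_one_smul] at h1
    exact (hasFDerivAt_fst (𝕜 := ℝ) (p := M (-t))).comp_hasDerivWithinAt t h1
  have hy : HasDerivWithinAt (fun t => (M (-t)).2) (-(vf γ φ (M (-t))).2) (-I) t := by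
    rw [neg_one_smul] at h1
    exact (hasFDerivAt_snd (𝕜 := ℝ) (p := M (-t))).comp_hasDerivWithinAt t h1
  rcases hA with rfl | rfl
  · rw [vf_rot]
    exact hy.neg.prodMk hx
  · rw [vf_rotInv]
    have := hy.prodMk hx.neg
    exact this

theorem rev_max {γ : ℝ} {φ : ℝ → ℝ} {I : Set ℝ} {M : ℝ → ℝ × ℝ} (hmax : IsMaxl (vf γ φ) I M) :
    IsMaxl (vf γ φ) (-I) (fun t => rot (M (-t))) := by
  intro J hJ hIJ N hN hflow
  have hJ' : (-J).OrdConnected :=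
    ⟨fun x hx y hy z hz => hJ.out hy hx ⟨neg_le_neg hz.2, neg_le_neg hz.1⟩⟩
  have h := hmax (-J) hJ' (fun t ht => hIJ (by simpa using ht)) (fun t => rotInv (N (-t)))
    (fun t ht => by
      have := hN (-t) (by simpa using ht)
      simp only [this, neg_neg]
      simp [rot, rotInv])
    (rev_aux (Or.inr rfl) hflow)
  intro t ht
  exact h (by simpa using ht)

/-- The function whose zero set is `X`. -/
def hh (γ : ℝ) (p : ℝ × ℝ) : ℝ := (p.1 - γ * p.2) * (p.2 + γ * p.1)

theorem mem_X_iff (γ : ℝ) (p : ℝ × ℝ) : p ∈ Xset γ ↔ hh γ p = 0 := by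
  simp only [Xset, hh, mem_ofPred_eq, mul_eq_zero]
  constructor
  · rintro (h | h)
    · left; linarith
    · right; linarith
  · rintro (h | h)
    · left; linarith
    · right; linarith

theorem hh_rot (γ : ℝ) (p : ℝ × ℝ) : hh γ (rot p) = -hh γ p := by
  simp only [hh, rot]; ring

theorem hh_continuous (γ : ℝ) : Continuous (hh γ) := by
  unfold hh; fun_prop

theorem eq_zero_of_uw {γ : ℝ} {p : ℝ × ℝ} (hu : p.1 - γ * p.2 = 0) (hw : p.2 + γ * p.1 = 0) :
    p = 0 := by
  have h1 : p.1 * (1 + γ ^ 2) = 0 := by linear_combination hu + γ * hw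
  have h2 : p.2 * (1 + γ ^ 2) = 0 := by linear_combination hw - γ * hu
  have h3 : 1 + γ ^ 2 ≠ 0 := by positivity
  exact Prod.ext ((mul_eq_zero.1 h1).resolve_right h3) ((mul_eq_zero.1 h2).resolve_right h3)

section flow
variable {γ : ℝ} {φ : ℝ → ℝ} {I : Set ℝ} {M : ℝ → ℝ × ℝ}

theorem IsFlow.fst {V : ℝ × ℝ → ℝ × ℝ} (hM : IsFlow V I M) {t : ℝ} (ht : t ∈ I) :
    HasDerivWithinAt (fun t => (M t).1) (V (M t)).1 I t := by
  exact (hasFDerivAt_fst (𝕜 := ℝ) (p := M t)).comp_hasDerivWithinAt t (hM t ht)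

theorem IsFlow.snd {V : ℝ × ℝ → ℝ × ℝ} (hM : IsFlow V I M) {t : ℝ} (ht : t ∈ I) :
    HasDerivWithinAt (fun t => (M t).2) (V (M t)).2 I t := by
  exact (hasFDerivAt_snd (𝕜 := ℝ) (p := M t)).comp_hasDerivWithinAt t (hM t ht)

/-- After meeting `X` (away from the origin), `hh` is negative. -/
theorem hh_neg_after (hγ : 0 < γ) (hφone : ∀ t ∈ Ici (0 : ℝ), 1 ≤ φ t) (hI : I.OrdConnected)
    (hM : IsFlow (vf γ φ) I M) (hne : ∀ t ∈ I, M t ≠ 0) {s t : ℝ} (hs : s ∈ I) (ht : t ∈ I)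
    (hst : s < t) (h0 : hh γ (M s) = 0) : hh γ (M t) < 0 := by
  have hsub := hI.out hs ht
  have hM' := hM.mono hsub
  refine neg_after (h := fun t => hh γ (M t)) hst
    (fun r hr => ((hM'.fst hr).sub ((hM'.snd hr).const_mul γ)).mul
      ((hM'.snd hr).add ((hM'.fst hr).const_mul γ))) ?_ h0.le
  intro r hr hr0
  obtain ⟨f, g, hf, hg, e1, e2⟩ := vf_form γ hφone (M r)
  have hMr := hne r (hsub hr)
  simp only [Pi.sub_apply, e1, e2]
  simp only [hh] at hr0
  set u := (M r).1 - γ * (M r).2 with hu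
  set w := (M r).2 + γ * (M r).1 with hw
  have hpos : 0 < w ^ 2 * g + u ^ 2 * f := by
    by_cases hu0 : u = 0
    · have hw0 : w ≠ 0 := fun hw0 => hMr (eq_zero_of_uw hu0 hw0)
      have := mul_pos (pow_pos (abs_pos.2 hw0) 2) hg
      rw [sq_abs] at this
      have := mul_nonneg (sq_nonneg u) hf.le
      linarith
    · have := mul_pos (pow_pos (abs_pos.2 hu0) 2) hf
      rw [sq_abs] at this
      have := mul_nonneg (sq_nonneg w) hg.le
      linarith
  have e : (-u * f - γ * (w * g)) * w + u * (w * g + γ * (-u * f))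
      = (u * w) * (g - f) - γ * (w ^ 2 * g + u ^ 2 * f) := by ring
  rw [e, hr0]
  nlinarith [mul_pos hγ hpos]

/-- When `hh > 0`, `x²` is decreasing. -/
theorem sq_anti (hγ : 0 < γ) (hφone : ∀ t ∈ Ici (0 : ℝ), 1 ≤ φ t) (hI : I.OrdConnected)
    (hM : IsFlow (vf γ φ) I M) (hpos : ∀ t ∈ I, 0 < hh γ (M t)) :
    AntitoneOn (fun t => (M t).1 ^ 2) I := by
  refine antitoneOn_of_hasDerivWithinAt_nonpos hI.convex
    (fun t ht => ((hM.fst ht).pow 2).continuousWithinAt)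
    (fun t ht => ((hM.fst (interior_subset ht)).pow 2).mono interior_subset) ?_
  intro t ht
  have hp := hpos t (interior_subset ht)
  obtain ⟨f, g, hf, hg, e1, e2⟩ := vf_form γ hφone (M t)
  rw [e1]
  simp only [hh] at hp
  have hx : (M t).1 * (1 + γ ^ 2) = ((M t).1 - γ * (M t).2) + γ * ((M t).2 + γ * (M t).1) := by
    ring
  set x := (M t).1
  set u := x - γ * (M t).2
  set w := (M t).2 + γ * x
  have hxu : 0 ≤ x * u := by
    have h1 : 0 ≤ (x * u) * (1 + γ ^ 2) := by
      have : (x * u) * (1 + γ ^ 2) = u ^ 2 + γ * (u * w) := by linear_combination u * hx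
      rw [this]; positivity
    exact nonneg_of_mul_nonneg_left h1 (by positivity)
  have := mul_nonneg hxu hf.le
  norm_num
  nlinarith

/-- In the region `u, w > 0` the flow converges to the origin. -/
theorem tendsto_of_pos (hγ : 0 < γ) (hφ : ContDiffOn ℝ (⊤ : ℕ∞) φ (Ici 0))
    (hφone : ∀ t ∈ Ici (0 : ℝ), 1 ≤ φ t) {t0 : ℝ} (hM : IsFlow (vf γ φ) (Ici t0) M)
    (hu : ∀ t ∈ Ici t0, 0 < (M t).1 - γ * (M t).2) (hw : ∀ t ∈ Ici t0, 0 < (M t).2 + γ * (M t).1) :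
    Tendsto M atTop (nhds 0) := by
  have hx : AntitoneOn (fun t => (M t).1) (Ici t0) := by
    refine antitoneOn_of_hasDerivWithinAt_nonpos (convex_Ici t0)
      (fun t ht => (hM.fst ht).continuousWithinAt)
      (fun t ht => (hM.fst (interior_subset ht)).mono interior_subset) ?_
    intro t ht
    obtain ⟨f, g, hf, hg, e1, e2⟩ := vf_form γ hφone (M t)
    rw [e1]
    nlinarith [mul_pos (hu t (interior_subset ht)) hf]
  have hy : MonotoneOn (fun t => (M t).2) (Ici t0) := by
    refine monotoneOn_of_hasDerivWithinAt_nonneg (convex_Ici t0)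
      (fun t ht => (hM.snd ht).continuousWithinAt)
      (fun t ht => (hM.snd (interior_subset ht)).mono interior_subset) ?_
    intro t ht
    obtain ⟨f, g, hf, hg, e1, e2⟩ := vf_form γ hφone (M t)
    rw [e2]
    nlinarith [mul_pos (hw t (interior_subset ht)) hg]
  have hxpos : ∀ t ∈ Ici t0, 0 < (M t).1 := by
    intro t ht
    have h1 : 0 < (M t).1 * (1 + γ ^ 2) := by
      nlinarith [hu t ht, mul_pos hγ (hw t ht)]
    exact pos_of_mul_pos_left h1 (by positivity)
  have hybd : ∀ t ∈ Ici t0, (M t).2 ≤ (M t0).1 / γ := by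
    intro t ht
    rw [le_div_iff₀ hγ]
    have h1 : (M t).1 ≤ (M t0).1 := hx self_mem_Ici ht ht
    nlinarith [hu t ht]
  have hmx : ∀ t, max t t0 ∈ Ici t0 := fun t => mem_Ici.2 (le_max_right _ _)
  obtain ⟨l, hl⟩ : ∃ l, Tendsto (fun t => (M t).1) atTop (nhds l) := by
    have ha : Antitone (fun t => (M (max t t0)).1) := fun s t hst =>
      hx (hmx s) (hmx t) (max_le_max_right _ hst)
    have hb : BddBelow (range (fun t => (M (max t t0)).1)) := by
      refine ⟨0, ?_⟩
      rintro _ ⟨t, rfl⟩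
      exact (hxpos _ (hmx t)).le
    refine ⟨_, (tendsto_atTop_ciInf ha hb).congr' ?_⟩
    filter_upwards [eventually_ge_atTop t0] with t ht
    rw [max_eq_left ht]
  obtain ⟨m, hm⟩ : ∃ m, Tendsto (fun t => (M t).2) atTop (nhds m) := by
    have ha : Monotone (fun t => (M (max t t0)).2) := fun s t hst =>
      hy (hmx s) (hmx t) (max_le_max_right _ hst)
    have hb : BddAbove (range (fun t => (M (max t t0)).2)) := by
      refine ⟨(M t0).1 / γ, ?_⟩
      rintro _ ⟨t, rfl⟩
      exact hybd _ (hmx t)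
    refine ⟨_, (tendsto_atTop_ciSup ha hb).congr' ?_⟩
    filter_upwards [eventually_ge_atTop t0] with t ht
    rw [max_eq_left ht]
  have hlim : Tendsto M atTop (nhds (l, m)) := hl.prodMk_nhds hm
  have hV : Tendsto (fun t => vf γ φ (M t)) atTop (nhds (vf γ φ (l, m))) :=
    ((vf_contDiff γ hφ).continuous.tendsto _).comp hlim
  have hnh : ∀ t, t0 < t → Ici t0 ∈ nhds t := fun t ht => Ici_mem_nhds ht
  have c1 := deriv_lim_zero (fun t ht => (hM.fst (le_of_lt ht)).hasDerivAt (hnh t ht)) hl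
    ((continuous_fst.tendsto _).comp hV)
  have c2 := deriv_lim_zero (fun t ht => (hM.snd (le_of_lt ht)).hasDerivAt (hnh t ht)) hm
    ((continuous_snd.tendsto _).comp hV)
  obtain ⟨f, g, hf, hg, e1, e2⟩ := vf_form γ hφone (l, m)
  rw [e1] at c1
  rw [e2] at c2
  have z1 := neg_eq_zero.1 ((mul_eq_zero.1 c1).resolve_right hf.ne')
  have z2 := (mul_eq_zero.1 c2).resolve_right hg.ne'
  rwa [eq_zero_of_uw z1 z2] at hlim

/-- A maximal flow line in `hh > 0`. -/
theorem main_pos (hγ : 0 < γ) (hφ : ContDiffOn ℝ (⊤ : ℕ∞) φ (Ici 0))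
    (hφone : ∀ t ∈ Ici (0 : ℝ), 1 ≤ φ t) (hI : I.OrdConnected) (hne : I.Nonempty)
    (hM : IsFlow (vf γ φ) I M) (hmax : IsMaxl (vf γ φ) I M) (hpos : ∀ t ∈ I, 0 < hh γ (M t)) :
    ((∀ s : ℝ, ∃ t ∈ I, s ≤ t) ∧ Tendsto M (atTop ⊓ 𝓟 I) (nhds 0)) ∧
      ¬ ((∀ s : ℝ, ∃ t ∈ I, t ≤ s) ∧ Tendsto M (atBot ⊓ 𝓟 I) (nhds 0)) := by
  obtain ⟨t0, ht0⟩ := hne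
  have hanti := sq_anti hγ hφone hI hM hpos
  have hkey : ∀ t ∈ I, ((M t).1 - γ * (M t).2) ^ 2 + γ ^ 2 * ((M t).2 + γ * (M t).1) ^ 2
      < (M t).1 ^ 2 * (1 + γ ^ 2) ^ 2 := by
    intro t ht
    have := hpos t ht
    simp only [hh] at this
    nlinarith [mul_pos hγ this]
  have hxpos : 0 < (M t0).1 ^ 2 := by
    have h1 := hkey t0 ht0
    have h2 : 0 < (M t0).1 ^ 2 * (1 + γ ^ 2) ^ 2 := lt_of_le_of_lt (by positivity) h1
    exact pos_of_mul_pos_left h2 (by positivity)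
  constructor
  · have hnb : ¬ BddAbove I := by
      set X := |(M t0).1| with hX
      have hX0 : 0 ≤ X := abs_nonneg _
      refine unbdd_of_bdd (vf_contDiff γ hφ) hI hM hmax ht0
        (R := max X ((X * (1 + γ ^ 2) + X) / γ)) ?_
      intro t ht hle
      have h1 : |(M t).1| ≤ X := sq_le_sq.1 (hanti ht0 ht hle)
      have h2 : |(M t).1 - γ * (M t).2| ≤ X * (1 + γ ^ 2) := by
        have : ((M t).1 - γ * (M t).2) ^ 2 ≤ ((M t).1 * (1 + γ ^ 2)) ^ 2 := by
          have := hkey t ht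
          nlinarith [mul_nonneg (sq_nonneg γ) (sq_nonneg ((M t).2 + γ * (M t).1))]
        have := sq_le_sq.1 this
        rw [abs_mul, abs_of_pos (show (0 : ℝ) < 1 + γ ^ 2 by positivity)] at this
        exact this.trans (by gcongr)
      have h3 : |(M t).2| ≤ (X * (1 + γ ^ 2) + X) / γ := by
        rw [le_div_iff₀ hγ]
        rw [abs_le] at h1 h2
        rw [← abs_of_pos hγ, ← abs_mul, abs_le, abs_of_pos hγ]
        constructor <;> linarith [h1.1, h1.2, h2.1, h2.2]
      rw [Prod.norm_def]
      exact max_le_max h1 h3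
    have hun : ∀ s : ℝ, ∃ t ∈ I, s ≤ t := fun s => by
      rw [not_bddAbove_iff] at hnb
      obtain ⟨t, ht, h⟩ := hnb s
      exact ⟨t, ht, h.le⟩
    refine ⟨hun, ?_⟩
    have hsub : Ici t0 ⊆ I := fun t ht => by
      obtain ⟨r, hr, h⟩ := hun t
      exact hI.out ht0 hr ⟨ht, h⟩
    have hM' := hM.mono hsub
    refine Tendsto.mono_left ?_ inf_le_left
    have hcu : ContinuousOn (fun t => (M t).1 - γ * (M t).2) (Ici t0) := by
      have := hM'.cont
      fun_prop
    rcases const_sign ordConnected_Ici hcu (fun t ht h => by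
        have := hpos t (hsub ht)
        simp [hh, h] at this) with h | h
    · refine tendsto_of_pos hγ hφ hφone hM' h fun t ht => ?_
      exact pos_of_mul_pos_right (hpos t (hsub ht)) (h t ht).le
    · have hn : IsFlow (vf γ φ) (Ici t0) (fun t => -M t) := fun t ht => by
        rw [vf_neg]; exact (hM' t ht).neg
      have := tendsto_of_pos hγ hφ hφone hn
        (fun t ht => by
          have := h t ht
          simp only [Prod.fst_neg, Prod.snd_neg]; linarith)
        (fun t ht => by
          have h1 := h t ht
          have h2 := hpos t (hsub ht)
          simp only [hh] at h2
          have := neg_of_mul_pos_right h2 h1.le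
          simp only [Prod.fst_neg, Prod.snd_neg]; linarith)
      simpa using this.neg
  · rintro ⟨hun, hlim⟩
    have hx : Tendsto (fun t => (M t).1 ^ 2) (atBot ⊓ 𝓟 I) (nhds 0) := by
      have : Tendsto (fun p : ℝ × ℝ => p.1 ^ 2) (nhds 0) (nhds 0) :=
        Continuous.tendsto' (by fun_prop) _ _ (by simp)
      exact this.comp hlim
    have hev : ∀ᶠ t in atBot ⊓ 𝓟 I, (M t0).1 ^ 2 ≤ (M t).1 ^ 2 := by
      rw [eventually_inf_principal]
      filter_upwards [eventually_le_atBot t0] with t ht htI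
      exact hanti htI ht0 ht
    have : (atBot ⊓ 𝓟 I : Filter ℝ).NeBot := by
      rw [← frequently_mem_iff_neBot, frequently_atBot]
      intro s
      obtain ⟨t, ht, h⟩ := hun s
      exact ⟨t, h, ht⟩
    exact absurd (ge_of_tendsto hx hev) (not_le.2 hxpos)

theorem tendsto_neg_aux (F G : Filter ℝ) (hFG : Tendsto Neg.neg F G)
    (h : Tendsto (fun t => rot (M (-t))) (G ⊓ 𝓟 (-I)) (nhds 0)) :
    Tendsto M (F ⊓ 𝓟 I) (nhds 0) := by
  have h1 : Tendsto (Neg.neg : ℝ → ℝ) (F ⊓ 𝓟 I) (G ⊓ 𝓟 (-I)) :=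
    hFG.inf (tendsto_principal_principal.2 fun t ht => by simpa using ht)
  have h2 := h.comp h1
  have h3 : Tendsto rotInv (nhds 0) (nhds 0) :=
    Continuous.tendsto' (by unfold rotInv; fun_prop) _ _ (by simp [rotInv])
  refine (h3.comp h2).congr fun t => ?_
  simp [rot, rotInv]

theorem tendsto_neg_aux' (F G : Filter ℝ) (hFG : Tendsto Neg.neg F G)
    (h : Tendsto M (G ⊓ 𝓟 I) (nhds 0)) :
    Tendsto (fun t => rot (M (-t))) (F ⊓ 𝓟 (-I)) (nhds 0) := by
  have h1 : Tendsto (Neg.neg : ℝ → ℝ) (F ⊓ 𝓟 (-I)) (G ⊓ 𝓟 I) :=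
    hFG.inf (tendsto_principal_principal.2 fun t ht => by simpa using ht)
  have h3 : Tendsto rot (nhds 0) (nhds 0) :=
    Continuous.tendsto' (by unfold rot; fun_prop) _ _ (by simp [rot])
  exact (h3.comp (h.comp h1))

/-- A maximal flow line in `hh < 0`. -/
theorem main_neg (hγ : 0 < γ) (hφ : ContDiffOn ℝ (⊤ : ℕ∞) φ (Ici 0))
    (hφone : ∀ t ∈ Ici (0 : ℝ), 1 ≤ φ t) (hI : I.OrdConnected) (hne : I.Nonempty)
    (hM : IsFlow (vf γ φ) I M) (hmax : IsMaxl (vf γ φ) I M) (hneg : ∀ t ∈ I, hh γ (M t) < 0) :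
    ((∀ s : ℝ, ∃ t ∈ I, t ≤ s) ∧ Tendsto M (atBot ⊓ 𝓟 I) (nhds 0)) ∧
      ¬ ((∀ s : ℝ, ∃ t ∈ I, s ≤ t) ∧ Tendsto M (atTop ⊓ 𝓟 I) (nhds 0)) := by
  have hI' : (-I).OrdConnected :=
    ⟨fun x hx y hy z hz => hI.out hy hx ⟨neg_le_neg hz.2, neg_le_neg hz.1⟩⟩
  obtain ⟨⟨a1, a2⟩, b⟩ := main_pos hγ hφ hφone hI' hne.neg (rev_aux (Or.inl rfl) hM)
    (rev_max hmax) (fun t ht => by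
      rw [hh_rot]
      have := hneg (-t) ht
      linarith)
  refine ⟨⟨fun s => ?_, tendsto_neg_aux _ _ tendsto_neg_atBot_atTop a2⟩, ?_⟩
  · obtain ⟨t, ht, h⟩ := a1 (-s)
    exact ⟨-t, ht, by linarith⟩
  · rintro ⟨c1, c2⟩
    refine b ⟨fun s => ?_, tendsto_neg_aux' _ _ tendsto_neg_atBot_atTop c2⟩
    obtain ⟨t, ht, h⟩ := c1 (-s)
    exact ⟨-t, by simpa using ht, by linarith⟩

end flow

/-- For a complete (i.e. maximal) flow line `(M(t))_{t ∈ I}` of the vector field `v`,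
exactly one of the following holds: (0) the flow line stays put at the origin; (1) it meets
`X` at exactly one time; (2) it never meets `X` and converges to the origin as `t → +∞`;
(3) it never meets `X` and converges to the origin as `t → -∞`. -/
theorem statement_10 (γ : ℝ) (hγ : γ ^ 3 + γ ^ 2 + γ - 1 / 3 = 0)
    (φ : ℝ → ℝ) (hφsmooth : ContDiffOn ℝ (⊤ : ℕ∞) φ (Ici 0))
    (hφmono : MonotoneOn φ (Ici 0))
    (hφone : ∀ t ∈ Ici (0 : ℝ), 1 ≤ φ t)
    (hφlow : ∀ t ∈ Icc (0 : ℝ) (1 / 2), φ t = 1)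
    (hφhigh : ∀ t ∈ Ici (1 : ℝ), φ t = 2 * t)
    (I : Set ℝ) (hI : I.OrdConnected) (hne : I.Nonempty)
    (M : ℝ → ℝ × ℝ)
    (hflow : ∀ t ∈ I, HasDerivWithinAt M (vf γ φ (M t)) I t)
    (hmax : ∀ J : Set ℝ, J.OrdConnected → I ⊆ J → ∀ N : ℝ → ℝ × ℝ,
      (∀ t ∈ I, N t = M t) → (∀ t ∈ J, HasDerivWithinAt N (vf γ φ (N t)) J t) → J ⊆ I) :
    let P0 : Prop := ∀ t ∈ I, M t = (0, 0)
    let P1 : Prop := ∃! t : ℝ, t ∈ I ∧ M t ∈ Xset γ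
    let P2 : Prop := (∀ t ∈ I, M t ∉ Xset γ) ∧ (∀ s : ℝ, ∃ t ∈ I, s ≤ t) ∧
      Tendsto M (atTop ⊓ 𝓟 I) (nhds (0, 0))
    let P3 : Prop := (∀ t ∈ I, M t ∉ Xset γ) ∧ (∀ s : ℝ, ∃ t ∈ I, t ≤ s) ∧
      Tendsto M (atBot ⊓ 𝓟 I) (nhds (0, 0))
    (P0 ∧ ¬P1 ∧ ¬P2 ∧ ¬P3) ∨ (¬P0 ∧ P1 ∧ ¬P2 ∧ ¬P3) ∨
      (¬P0 ∧ ¬P1 ∧ P2 ∧ ¬P3) ∨ (¬P0 ∧ ¬P1 ∧ ¬P2 ∧ P3) := by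
  intro P0 P1 P2 P3
  have hg := gamma_pos hγ
  have hM : IsFlow (vf γ φ) I M := hflow
  have hmx : IsMaxl (vf γ φ) I M := hmax
  have hV := vf_contDiff γ hφsmooth
  have h00 : ((0, 0) : ℝ × ℝ) = 0 := rfl
  have n12 : P1 → ¬P2 := fun ⟨t, ht, _⟩ h => h.1 t ht.1 ht.2
  have n13 : P1 → ¬P3 := fun ⟨t, ht, _⟩ h => h.1 t ht.1 ht.2
  by_cases h0 : P0
  · left
    obtain ⟨t0, ht0⟩ := hne
    have hX : ∀ t ∈ I, M t ∈ Xset γ := fun t ht => by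
      rw [h0 t ht]; simp [Xset]
    refine ⟨h0, ?_, fun h => h.1 t0 ht0 (hX t0 ht0), fun h => h.1 t0 ht0 (hX t0 ht0)⟩
    rintro ⟨t1, _, h1⟩
    have hnb := unbdd_of_bdd hV hI hM hmx ht0 (R := 0) (fun t ht _ => by
      rw [h0 t ht, h00, norm_zero])
    refine hnb ⟨t1, fun t ht => (h1 t ⟨ht, hX t ht⟩).le⟩
  · have hnz : ∀ t ∈ I, M t ≠ 0 := fun t ht hz =>
      h0 (zero_of_zero hV (vf_zero γ φ) hI hM ht hz)
    by_cases hm : ∃ t ∈ I, M t ∈ Xset γ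
    · have p1 : P1 := by
        obtain ⟨t, ht, hX⟩ := hm
        refine ⟨t, ⟨ht, hX⟩, fun s ⟨hs, hsX⟩ => ?_⟩
        rw [mem_X_iff] at hX hsX
        rcases lt_trichotomy s t with h | h | h
        · exact absurd hX (hh_neg_after hg hφone hI hM hnz hs ht h hsX).ne
        · exact h
        · exact absurd hsX (hh_neg_after hg hφone hI hM hnz ht hs h hX).ne
      exact Or.inr (Or.inl ⟨h0, p1, n12 p1, n13 p1⟩)
    · push Not at hm
      have n1 : ¬P1 := fun ⟨t, ht, _⟩ => hm t ht.1 ht.2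
      rcases const_sign hI ((hh_continuous γ).comp_continuousOn hM.cont)
        (fun t ht h => hm t ht ((mem_X_iff _ _).2 h)) with h | h
      · obtain ⟨a, b⟩ := main_pos hg hφsmooth hφone hI hne hM hmx h
        exact Or.inr (Or.inr (Or.inl ⟨h0, n1, ⟨hm, a⟩, fun h => b h.2⟩))
      · obtain ⟨a, b⟩ := main_neg hg hφsmooth hφone hI hne hM hmx h
        exact Or.inr (Or.inr (Or.inr ⟨h0, n1, fun h => b h.2, ⟨hm, a⟩⟩))
end
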